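/- Let K be an algebraically closed field of characteristic 0 and let d ≥ 2 be an integer. Let f and g be disintegrated polynomials in K[x] of degree at most d such that f ≈ g. Then there exist a positive integer N ≤ 2d^4 and a polynomial η ∈ K[x] of degree at least 2 that is semiconjugate to both f^{∘N} and g^{∘N}. -/

import Mathlib

open Polynomial

/-- The Chebyshev polynomial `T_n` satisfying `T_n(x + 1/x) = x^n + 1/x^n`
(the Dickson polynomial of the first kind with parameter 1). -/
noncomputable def cheb (K : Type*) [CommRing K] (n : ℕ) : K[X] :=
  Polynomial.dickson 1 1 n

/-- The `n`-fold compositional iterate of a polynomial. -/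
noncomputable def polyIter {K : Type*} [CommRing K] (f : K[X]) : ℕ → K[X]
  | 0 => X
  | n + 1 => f.comp (polyIter f n)

/-- `f` is linearly conjugate to `g`, i.e. `f = ℓ ∘ g ∘ ℓ⁻¹` for a degree-1 polynomial `ℓ`. -/
def LinConj {K : Type*} [CommRing K] (f g : K[X]) : Prop :=
  ∃ ℓ ℓi : K[X], ℓ.degree = 1 ∧ ℓi.degree = 1 ∧ ℓ.comp ℓi = X ∧ ℓi.comp ℓ = X ∧
    f = ℓ.comp (g.comp ℓi)

/-- A polynomial is disintegrated if it has degree `δ ≥ 2` and is not linearly conjugate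
to `x^δ` or `±T_δ(x)`. -/
def Disintegrated {K : Type*} [CommRing K] (f : K[X]) : Prop :=
  2 ≤ f.natDegree ∧ ¬ LinConj f (X ^ f.natDegree) ∧
    ¬ LinConj f (cheb K f.natDegree) ∧ ¬ LinConj f (-(cheb K f.natDegree))

/-- `η` (of degree at least 2) is semiconjugate to `f` if `f ∘ p = p ∘ η` for some
non-constant polynomial `p`. -/
def SemiconjTo {K : Type*} [CommRing K] (η f : K[X]) : Prop :=
  ∃ p : K[X], 0 < p.natDegree ∧ f.comp p = p.comp η

/-- `f ≈ g`: there exist `N ≥ 1` and a polynomial `η` (of degree at least 2) semiconjugate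
to both `f^{∘N}` and `g^{∘N}`. -/
def PolyApprox {K : Type*} [CommRing K] (f g : K[X]) : Prop :=
  ∃ N : ℕ, 1 ≤ N ∧ ∃ η : K[X], 2 ≤ η.natDegree ∧
    SemiconjTo η (polyIter f N) ∧ SemiconjTo η (polyIter g N)

namespace USB

/-- total degree homomorphism: `t ↦ T`, `S ↦ σ T` -/
noncomputable def Th (K : Type*) [Field K] : K[X][X] →+* K[X][X] :=
  eval₂RingHom (mapRingHom C) (C X * X)

theorem Th_coeff {K : Type*} [Field K] (P : K[X][X]) (k i : ℕ) :
    ((Th K P).coeff k).coeff i = if i ≤ k then (P.coeff i).coeff (k - i) else 0 := by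
  induction P using Polynomial.induction_on' with
  | add p q hp hq => 
    rw [map_add, coeff_add, coeff_add, hp, hq]
    split_ifs <;> simp
  | monomial n a =>
    have h1 : Th K (monomial n a) = a.map C * C (X ^ n) * X ^ n := by
      simp [Th, eval₂_monomial, mul_pow, mul_assoc]
    rw [h1, coeff_mul_X_pow', coeff_monomial]
    by_cases hnk : n ≤ k
    · rw [if_pos hnk, coeff_mul_C, coeff_map, coeff_C_mul, coeff_X_pow]
      by_cases h : i = n
      · subst h; simp [hnk]
      · simp [h, Ne.symm h]
    · rw [if_neg hnk]
      by_cases h : n = i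
      · subst h; simp [hnk]
      · simp [h]

/-- the polynomial `x(S) - x(t)` -/
noncomputable def PP {K : Type*} [Field K] (x : K[X]) : K[X][X] := x.map C - C x

theorem Th_PP_coeff {K : Type*} [Field K] (x : K[X]) (k : ℕ) :
    (Th K (PP x)).coeff k = C (x.coeff k) * (X ^ k - 1) := by
  ext i
  rw [Th_coeff, PP, coeff_C_mul, coeff_sub, coeff_map, coeff_sub, coeff_sub, coeff_C, coeff_C,
    coeff_X_pow, coeff_one]
  by_cases hk : k = 0
  · subst hk
    by_cases hi : i = 0
    · subst hi; simp
    · simp [hi]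
  · by_cases hi : i = 0
    · subst hi; simp [hk, Ne.symm hk]
    · by_cases hik : i = k
      · subst hik; simp [hi]
      · by_cases h : i ≤ k
        · simp [hi, hik, h, show k - i ≠ 0 by omega]
        · simp [hi, hik, h]

theorem Th_PP_natDegree {K : Type*} [Field K] (x : K[X]) (hx : 0 < x.natDegree) :
    (Th K (PP x)).natDegree = x.natDegree := by
  apply natDegree_eq_of_le_of_coeff_ne_zero
  · rw [natDegree_le_iff_coeff_eq_zero]
    intro k hk
    rw [Th_PP_coeff, coeff_eq_zero_of_natDegree_lt hk]; simp
  · rw [Th_PP_coeff]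
    have h0 : x ≠ 0 := by rintro rfl; simp at hx
    refine mul_ne_zero (by simpa using h0) (X_pow_sub_C_ne_zero hx (1:K))

theorem Th_PP_lc {K : Type*} [Field K] (x : K[X]) (hx : 0 < x.natDegree) :
    (Th K (PP x)).leadingCoeff = C x.leadingCoeff * (X ^ x.natDegree - 1) := by
  rw [leadingCoeff, Th_PP_natDegree x hx, Th_PP_coeff]; rfl

theorem PP_monic {K : Type*} [Field K] {x : K[X]} (hx : x.Monic) (h : 0 < x.natDegree) :
    (PP x).Monic := by
  apply (hx.map C).sub_of_left
  rw [degree_map]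
  exact lt_of_le_of_lt degree_C_le (natDegree_pos_iff_degree_pos.1 h)

theorem PP_natDegree {K : Type*} [Field K] {x : K[X]} :
    (PP x).natDegree = x.natDegree := by
  rw [PP, natDegree_sub_C, natDegree_map]

theorem Th_natDegree_ge {K : Type*} [Field K] {m : K[X][X]} (hm : m.Monic) :
    m.natDegree ≤ (Th K m).natDegree := by
  apply le_natDegree_of_ne_zero
  intro h
  have := congrArg (fun q => coeff q m.natDegree) h
  simp only [Th_coeff] at this
  simp [hm] at this

theorem Th_ne_zero {K : Type*} [Field K] {m : K[X][X]} (hm : m.Monic) : Th K m ≠ 0 := by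
  intro h
  have := congrArg (fun q => (q.coeff m.natDegree).coeff m.natDegree) h
  simp only [Th_coeff] at this
  simp [hm] at this

theorem PP_dvd_PP_comp {K : Type*} [Field K] (A x : K[X]) : PP x ∣ PP (A.comp x) := by
  have h1 : PP (A.comp x) = (A.map (C.comp C)).eval (x.map C) - (A.map (C.comp C)).eval (C x) := by
    rw [PP, map_comp, comp, comp, eval₂_map, eval_map, eval_map]
    congr 1
    rw [hom_eval₂]
  rw [h1]
  exact sub_dvd_eval_sub _ _ _

/-- polynomials of the form `X^k-1`. -/
theorem dvd_pow_gcd {K : Type*} [Field K] {m : K[X]} {a b : ℕ} (ha : m ∣ X ^ a - 1)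
    (hb : m ∣ X ^ b - 1) : m ∣ X ^ (Nat.gcd a b) - 1 := by
  have key : ∀ k, m ∣ X ^ k - 1 ↔ (Ideal.Quotient.mk (Ideal.span {m}) X) ^ k = 1 := by
    intro k
    rw [← map_pow, ← map_one (Ideal.Quotient.mk (Ideal.span {m})), Ideal.Quotient.eq,
      Ideal.mem_span_singleton]
  rw [key] at *
  exact pow_gcd_eq_one.2 ⟨ha, hb⟩

theorem pow_sub_one_dvd {K : Type*} [Field K] {g k : ℕ} (hk : 0 < k)
    (h : (X ^ g - 1 : K[X]) ∣ X ^ k - 1) : g ∣ k := by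
  have h2 := dvd_pow_gcd (dvd_refl (X ^ g - 1 : K[X])) h
  have hpos : 0 < Nat.gcd g k := Nat.gcd_pos_of_pos_right _ hk
  have h3 := natDegree_le_of_dvd h2 (X_pow_sub_C_ne_zero hpos (1:K))
  have e : ∀ n, (X ^ n - 1 : K[X]).natDegree = n := fun n => natDegree_X_pow_sub_C (r := (1:K))
  rw [e, e] at h3
  have h4 : Nat.gcd g k ∣ g := Nat.gcd_dvd_left _ _
  rcases Nat.eq_zero_or_pos g with h0 | h0
  · subst h0
    rw [pow_zero, sub_self, zero_dvd_iff] at h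
    exact absurd h (X_pow_sub_C_ne_zero hk (1:K))
  · have := le_antisymm h3 (Nat.le_of_dvd h0 h4)
    rw [this]; exact Nat.gcd_dvd_right _ _

theorem X_pow_sub_one_dvd_of_dvd {K : Type*} [Field K] {g k : ℕ} (h : g ∣ k) :
    (X ^ g - 1 : K[X]) ∣ X ^ k - 1 := by
  obtain ⟨j, rfl⟩ := h
  rw [pow_mul]
  simpa using sub_dvd_pow_sub_pow (X ^ g : K[X]) 1 j

theorem lf_dvd {K : Type*} [Field K] [CharZero K] {m : K[X]} {a b n : ℕ} (hn : 0 < n)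
    (ha : a ∣ n)
    (h : ((X ^ a - 1) * (X ^ b - 1) : K[X]) ∣ m * (X ^ n - 1)) :
    (X ^ (Nat.gcd a b) - 1 : K[X]) ∣ m := by
  set g := Nat.gcd a b with hg
  have hgn : g ∣ n := (Nat.gcd_dvd_left a b).trans ha
  have hgpos : 0 < g := Nat.pos_of_dvd_of_pos hgn hn
  obtain ⟨w, hw⟩ := X_pow_sub_one_dvd_of_dvd (K := K) hgn
  have hsep : (X ^ n - 1 : K[X]).Separable :=
    separable_X_pow_sub_C (1:K) (by exact_mod_cast hn.ne') one_ne_zero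
  rw [hw] at hsep
  have hcop := hsep.isCoprime
  have h1 : ((X ^ g - 1) * (X ^ g - 1) : K[X]) ∣ (X ^ g - 1) * (m * w) := by
    refine (mul_dvd_mul (X_pow_sub_one_dvd_of_dvd (Nat.gcd_dvd_left a b))
      (X_pow_sub_one_dvd_of_dvd (Nat.gcd_dvd_right a b))).trans (h.trans ?_)
    rw [hw]; exact ⟨1, by ring⟩
  have h2 := (mul_dvd_mul_iff_left (X_pow_sub_C_ne_zero hgpos (1:K))).1 h1
  exact hcop.dvd_of_dvd_mul_right h2

theorem mem_adjoin_of_dvd {K : Type*} [Field K] {m : K[X][X]} {g : ℕ} {c : K[X]}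
    (hg : ∀ h : K[X], m ∣ PP h → 0 < h.natDegree → g ∣ h.natDegree)
    (hc : m ∣ PP c) (hcg : c.natDegree = g) (hgpos : 0 < g) :
    ∀ n, ∀ h : K[X], h.natDegree ≤ n → m ∣ PP h → ∃ h' : K[X], h = h'.comp c := by
  intro n
  induction n with
  | zero =>
    intro h hn _
    obtain ⟨a, ha⟩ := natDegree_eq_zero.1 (Nat.le_zero.1 hn)
    exact ⟨C a, by rw [C_comp, ha]⟩
  | succ n ih =>
    intro h hn hh
    rcases Nat.eq_zero_or_pos h.natDegree with h0 | h0
    · exact ih h (by omega) hh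
    obtain ⟨k, hk⟩ := hg h hh h0
    have hc0 : c ≠ 0 := by rintro rfl; simp at hcg; omega
    set q : K[X] := C (h.leadingCoeff / c.leadingCoeff ^ k) * X ^ k with hq
    have hqc : q.comp c = C (h.leadingCoeff / c.leadingCoeff ^ k) * c ^ k := by simp [hq]
    have hlc : (c ^ k).leadingCoeff = c.leadingCoeff ^ k := leadingCoeff_pow _ _
    have hcl : c.leadingCoeff ^ k ≠ 0 := pow_ne_zero _ (leadingCoeff_ne_zero.2 hc0)
    have hl0 : h.leadingCoeff ≠ 0 := by
      rw [leadingCoeff_ne_zero]; rintro rfl; simp at h0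
    have hdeg : (h - q.comp c).natDegree ≤ n := by
      have : (h - q.comp c).degree < h.degree := by
        apply degree_sub_lt_left
        · rw [hqc, degree_C_mul (div_ne_zero hl0 hcl), degree_pow,
            degree_eq_natDegree (by rintro rfl; simp at h0), degree_eq_natDegree hc0, hk, hcg]
          norm_cast; simp [mul_comm]
        · rintro rfl; simp at h0
        · rw [hqc, leadingCoeff_mul, leadingCoeff_C, hlc, div_mul_cancel₀ _ hcl]
      rcases eq_or_ne (h - q.comp c) 0 with hz | hz
      · rw [hz]; simp
      · have := natDegree_lt_natDegree hz this
        omega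
    have hd : m ∣ PP (h - q.comp c) := by
      have : PP (h - q.comp c) = PP h - PP (q.comp c) := by
        simp only [PP, Polynomial.map_sub, C_sub]; ring
      rw [this]
      exact dvd_sub hh (hc.trans (PP_dvd_PP_comp _ _))
    obtain ⟨h', hh'⟩ := ih _ hdeg hd
    exact ⟨h' + q, by rw [add_comp, ← hh']; ring⟩
end USB

namespace USB

theorem engstrom_core {K : Type*} [Field K] [CharZero K] {A B x y : K[X]}
    (hx : x.Monic) (hy : y.Monic) (hxd : 0 < x.natDegree) (hyd : 0 < y.natDegree)
    (hA : 0 < A.natDegree) (hB : 0 < B.natDegree) (h : A.comp x = B.comp y) :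
    ∃ c x' y' : K[X], c.natDegree = Nat.gcd x.natDegree y.natDegree ∧ x = x'.comp c ∧
      y = y'.comp c := by
  classical
  let L := FractionRing K[X]
  let ι : K[X] →+* L := algebraMap K[X] L
  have hι : Function.Injective ι := IsFractionRing.injective K[X] L
  let E : Subfield L := Subfield.closure (Set.range (ι.comp C) ∪ {ι x, ι y})
  have hCE : ∀ k : K, ι (C k) ∈ E := fun k => Subfield.subset_closure (Or.inl ⟨k, rfl⟩)
  have hxE : ι x ∈ E := Subfield.subset_closure (Or.inr (by simp))
  have hyE : ι y ∈ E := Subfield.subset_closure (Or.inr (by simp))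
  let κ : K →+* E := (ι.comp C).codRestrict E.toSubring hCE
  let pE : (w : K[X]) → (hw : ι w ∈ E) → E[X] := fun w hw => w.map κ - C ⟨ι w, hw⟩
  have hpE : ∀ w hw, (pE w hw).map E.subtype = (PP w).map ι := by
    intro w hw
    simp only [pE, PP, Polynomial.map_sub, Polynomial.map_map, map_C]
    rfl
  have hpx0 : pE x hxE ≠ 0 := by
    intro h0
    have := hpE x hxE
    rw [h0, Polynomial.map_zero] at this
    exact ((PP_monic hx hxd).map ι).ne_zero this.symm
  let G0 : E[X] := EuclideanDomain.gcd (pE x hxE) (pE y hyE)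
  have hG0 : G0 ≠ 0 := fun h0 => hpx0 (EuclideanDomain.gcd_eq_zero_iff.1 h0).1
  let m0 : E[X] := G0 * C (G0.leadingCoeff⁻¹)
  have hm0 : m0.Monic := monic_mul_leadingCoeff_inv hG0
  have hu : IsUnit (C (G0.leadingCoeff⁻¹) : E[X]) :=
    isUnit_C.2 (isUnit_iff_ne_zero.2 (inv_ne_zero (leadingCoeff_ne_zero.2 hG0)))
  have hm0x : m0 ∣ pE x hxE := (hu.mul_right_dvd).2 (EuclideanDomain.gcd_dvd_left _ _)
  have hm0y : m0 ∣ pE y hyE := (hu.mul_right_dvd).2 (EuclideanDomain.gcd_dvd_right _ _)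
  obtain ⟨u, v, huv⟩ : ∃ u v, m0 = pE x hxE * u + pE y hyE * v := by
    have h0 : G0 = _ := EuclideanDomain.gcd_eq_gcd_ab (pE x hxE) (pE y hyE)
    refine ⟨EuclideanDomain.gcdA (pE x hxE) (pE y hyE) * C (G0.leadingCoeff⁻¹),
      EuclideanDomain.gcdB (pE x hxE) (pE y hyE) * C (G0.leadingCoeff⁻¹), ?_⟩
    rw [← mul_assoc, ← mul_assoc, ← add_mul, ← h0]
  have hmx : m0.map E.subtype ∣ (PP x).map ι := by
    rw [← hpE x hxE]; exact Polynomial.map_dvd _ hm0x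
  have hmy : m0.map E.subtype ∣ (PP y).map ι := by
    rw [← hpE y hyE]; exact Polynomial.map_dvd _ hm0y
  have huv' : m0.map E.subtype = (PP x).map ι * u.map E.subtype + (PP y).map ι * v.map E.subtype := by
    rw [huv, Polynomial.map_add, Polynomial.map_mul, Polynomial.map_mul, hpE, hpE]
  -- descend to `K[X][X]`
  obtain ⟨m, hm⟩ : ∃ m : K[X][X], m.map ι = m0.map E.subtype := by
    obtain ⟨g', hg'⟩ := IsIntegrallyClosed.eq_map_mul_C_of_dvd L (PP_monic hx hxd) hmx
    refine ⟨g', ?_⟩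
    rw [(hm0.map E.subtype).leadingCoeff] at hg'
    simpa using hg'
  have hmm : m.Monic := monic_of_injective hι (hm ▸ hm0.map E.subtype)
  have hdx : m ∣ PP x := (map_dvd_map ι hι hmm).1 (hm ▸ hmx)
  have hdy : m ∣ PP y := (map_dvd_map ι hι hmm).1 (hm ▸ hmy)
  set z := A.comp x with hz
  have hxz : PP x ∣ PP z := PP_dvd_PP_comp _ _
  have hyz : PP y ∣ PP z := h ▸ PP_dvd_PP_comp _ _
  have hprod : PP x * PP y ∣ m * PP z := by
    apply (map_dvd_map ι hι ((PP_monic hx hxd).mul (PP_monic hy hyd))).1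
    rw [Polynomial.map_mul, Polynomial.map_mul, hm, huv', add_mul]
    apply dvd_add
    · rw [mul_assoc]
      exact mul_dvd_mul_left _ ((Polynomial.map_dvd ι hyz).mul_left _)
    · rw [mul_comm, mul_assoc]
      exact mul_dvd_mul_left _ ((Polynomial.map_dvd ι hxz).mul_left _)
  have hzd : z.natDegree = A.natDegree * x.natDegree := natDegree_comp
  have hzpos : 0 < z.natDegree := by rw [hzd]; positivity
  -- leading forms
  have hlf : (Th K m).natDegree = m.natDegree := by
    obtain ⟨Q, hQ⟩ := hdx
    have hQm : Q.Monic := hmm.of_mul_monic_left (hQ ▸ PP_monic hx hxd)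
    have h1 : x.natDegree = m.natDegree + Q.natDegree := by
      rw [← hmm.natDegree_mul hQm, ← hQ, PP_natDegree]
    have h2 : x.natDegree = (Th K m).natDegree + (Th K Q).natDegree := by
      rw [← Th_PP_natDegree x hxd, hQ, map_mul, natDegree_mul (Th_ne_zero hmm) (Th_ne_zero hQm)]
    have h3 := Th_natDegree_ge hmm
    have h4 := Th_natDegree_ge hQm
    omega
  set μ := (Th K m).leadingCoeff with hμ
  have hμdvd : ∀ w : K[X], m ∣ PP w → 0 < w.natDegree → μ ∣ X ^ w.natDegree - 1 := by
    intro w hw hwd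
    obtain ⟨Q, hQ⟩ := hw
    have h1 := Th_PP_lc w hwd
    rw [hQ, map_mul, leadingCoeff_mul] at h1
    have h2 : μ ∣ C w.leadingCoeff * (X ^ w.natDegree - 1) := ⟨_, h1.symm⟩
    have hw0 : w ≠ 0 := by rintro rfl; simp at hwd
    rwa [IsUnit.dvd_mul_left (isUnit_C.2 (isUnit_iff_ne_zero.2 (leadingCoeff_ne_zero.2 hw0)))] at h2
  set g := Nat.gcd x.natDegree y.natDegree with hg
  have hgpos : 0 < g := Nat.gcd_pos_of_pos_left _ hxd
  have hμ1 : μ ∣ X ^ g - 1 := dvd_pow_gcd (hμdvd x hdx hxd) (hμdvd y hdy hyd)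
  have hμ2 : (X ^ g - 1 : K[X]) ∣ μ := by
    apply lf_dvd hzpos (n := z.natDegree) (hzd ▸ dvd_mul_left _ _)
    obtain ⟨Q, hQ⟩ := hprod
    have := congrArg (fun q => (Th K q).leadingCoeff) hQ
    simp only [map_mul, leadingCoeff_mul] at this
    rw [Th_PP_lc x hxd, Th_PP_lc y hyd, Th_PP_lc z hzpos, hx.leadingCoeff, hy.leadingCoeff] at this
    simp only [C_1, one_mul] at this
    have h2 : ((X ^ x.natDegree - 1) * (X ^ y.natDegree - 1) : K[X]) ∣
        C z.leadingCoeff * (μ * (X ^ z.natDegree - 1)) := ⟨_, by rw [← this]; ring⟩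
    have hw0 : z ≠ 0 := by intro h0; rw [h0] at hzpos; simp at hzpos
    rwa [IsUnit.dvd_mul_left (isUnit_C.2 (isUnit_iff_ne_zero.2 (leadingCoeff_ne_zero.2 hw0)))] at h2
  have e : ∀ n, (X ^ n - 1 : K[X]).natDegree = n := fun n => natDegree_X_pow_sub_C (r := (1:K))
  have hμc : μ.coeff m.natDegree = 1 := by
    rw [hμ, leadingCoeff, hlf, Th_coeff]; simp [hmm]
  have hμ0 : μ ≠ 0 := by rintro h0; rw [h0] at hμc; simp at hμc
  have hDg : m.natDegree = g := by
    have h1 := natDegree_le_of_dvd hμ1 (X_pow_sub_C_ne_zero hgpos (1:K))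
    have h2 := natDegree_le_of_dvd hμ2 hμ0
    rw [e] at h1 h2
    have h3 : m.natDegree ≤ μ.natDegree := le_natDegree_of_ne_zero (by rw [hμc]; exact one_ne_zero)
    have h4 : μ.natDegree ≤ m.natDegree := by
      rw [natDegree_le_iff_coeff_eq_zero]
      intro i hi
      rw [hμ, leadingCoeff, hlf, Th_coeff, if_neg (by omega)]
    omega
  have hBdeg : ∀ w : K[X], m ∣ PP w → 0 < w.natDegree → g ∣ w.natDegree := fun w hw hwd =>
    pow_sub_one_dvd hwd (hμ2.trans (hμdvd w hw hwd))
  have hcoefdeg : ∀ i, (m.coeff i).natDegree ≤ g - i := by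
    intro i
    rcases le_or_gt i g with hi | hi
    · rw [natDegree_le_iff_coeff_eq_zero]
      intro j hj
      have h1 : ((Th K m).coeff (i + j)).coeff i = (m.coeff i).coeff j := by
        rw [Th_coeff]; simp
      rw [← h1, coeff_eq_zero_of_natDegree_lt (p := Th K m) (by rw [hlf, hDg]; omega)]; simp
    · rw [coeff_eq_zero_of_natDegree_lt (by omega)]; simp
  -- elements of `E` are constant on classes
  have hE : ∀ e ∈ E, ∃ a b : K[X], b ≠ 0 ∧ e * ι b = ι a ∧ m ∣ PP a ∧ m ∣ PP b := by
    have hPadd : ∀ a b : K[X], m ∣ PP a → m ∣ PP b → m ∣ PP (a + b) := by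
      intro a b ha hb
      have : PP (a + b) = PP a + PP b := by simp only [PP, Polynomial.map_add, C_add]; ring
      rw [this]; exact dvd_add ha hb
    have hPmul : ∀ a b : K[X], m ∣ PP a → m ∣ PP b → m ∣ PP (a * b) := by
      intro a b ha hb
      have : PP (a * b) = PP a * (b.map C) + C a * PP b := by
        simp only [PP, Polynomial.map_mul, C_mul]; ring
      rw [this]; exact dvd_add (ha.mul_right _) (hb.mul_left _)
    have hP1 : ∀ k : K, m ∣ PP (C k) := by intro k; simp [PP]
    have hPneg : ∀ a : K[X], m ∣ PP a → m ∣ PP (-a) := by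
      intro a ha
      have : PP (-a) = - PP a := by simp only [PP, Polynomial.map_neg, C_neg]; ring
      rw [this]; exact ha.neg_right
    intro e he
    induction he using Subfield.closure_induction with
    | mem w hw =>
      rcases hw with ⟨k, rfl⟩ | hw
      · exact ⟨C k, 1, one_ne_zero, by simp, hP1 k, by simpa using hP1 1⟩
      · rcases hw with rfl | rfl
        · exact ⟨x, 1, one_ne_zero, by simp, hdx, by simpa using hP1 1⟩
        · exact ⟨y, 1, one_ne_zero, by simp, hdy, by simpa using hP1 1⟩
    | one => exact ⟨1, 1, one_ne_zero, by simp, by simpa using hP1 1, by simpa using hP1 1⟩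
    | add p q _ _ hp hq =>
      obtain ⟨a, b, hb, h1, h2, h3⟩ := hp
      obtain ⟨a', b', hb', h1', h2', h3'⟩ := hq
      refine ⟨a * b' + a' * b, b * b', mul_ne_zero hb hb', ?_, ?_, hPmul _ _ h3 h3'⟩
      · simp only [map_add, map_mul, ← h1, ← h1']; ring
      · exact hPadd _ _ (hPmul _ _ h2 h3') (hPmul _ _ h2' h3)
    | neg p _ hp =>
      obtain ⟨a, b, hb, h1, h2, h3⟩ := hp
      exact ⟨-a, b, hb, by rw [map_neg, ← h1]; ring, hPneg _ h2, h3⟩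
    | inv p _ hp =>
      obtain ⟨a, b, hb, h1, h2, h3⟩ := hp
      by_cases hp0 : p = 0
      · exact ⟨0, 1, one_ne_zero, by simp [hp0], by simpa using hP1 0, by simpa using hP1 1⟩
      · refine ⟨b, a, ?_, ?_, h3, h2⟩
        · rintro rfl
          rw [map_zero] at h1
          rcases mul_eq_zero.1 h1 with h | h
          · exact hp0 h
          · exact hb (hι (by simpa using h))
        · rw [← h1, inv_mul_cancel_left₀ hp0]
    | mul p q _ _ hp hq =>
      obtain ⟨a, b, hb, h1, h2, h3⟩ := hp
      obtain ⟨a', b', hb', h1', h2', h3'⟩ := hq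
      refine ⟨a * a', b * b', mul_ne_zero hb hb', ?_, hPmul _ _ h2 h2', hPmul _ _ h3 h3'⟩
      simp only [map_mul, ← h1, ← h1']; ring
  have hEp : ∀ c : K[X], ι c ∈ E → m ∣ PP c := by
    intro c hc
    obtain ⟨a, b, hb, h1, h2, h3⟩ := hE _ hc
    have hcb : c * b = a := hι (by rw [map_mul, h1])
    apply (map_dvd_map ι hι hmm).1
    have h4 : m ∣ C b * PP c := by
      have : C b * PP c = PP a - c.map C * PP b := by
        rw [← hcb]; simp only [PP, Polynomial.map_mul, C_mul]; ring
      rw [this]; exact dvd_sub h2 (h3.mul_left _)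
    have h5 := Polynomial.map_dvd ι h4
    rw [Polynomial.map_mul, map_C] at h5
    have hb' : ι b ≠ 0 := fun h => hb (hι (by simpa using h))
    rwa [IsUnit.dvd_mul_left (isUnit_C.2 (isUnit_iff_ne_zero.2 hb'))] at h5
  have hcoefB : ∀ i, m ∣ PP (m.coeff i) := by
    intro i
    apply hEp
    have : ι (m.coeff i) = (m0.coeff i : L) := by
      rw [← coeff_map, hm, coeff_map]; rfl
    rw [this]; exact (m0.coeff i).2
  -- some coefficient is nonconstant
  have hroot : m.eval X = 0 := by
    apply hι
    rw [map_zero, ← eval₂_at_apply, ← eval_map, hm, huv', eval_add, eval_mul, eval_mul]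
    have : ∀ w : K[X], ((PP w).map ι).eval (ι X) = 0 := by
      intro w
      rw [eval_map, eval₂_at_apply]
      have : (PP w).eval X = 0 := by simp [PP, eval_map, eval₂_C_X]
      rw [this, map_zero]
    rw [this, this]; simp
  have hex : ∃ i, 0 < (m.coeff i).natDegree := by
    by_contra hcon
    push Not at hcon
    have hm1 : m = (m.map (evalRingHom 0)).map C := by
      ext i : 1
      rw [coeff_map, coeff_map]
      obtain ⟨a, ha⟩ := natDegree_eq_zero.1 (Nat.le_zero.1 (hcon i))
      rw [← ha]; simp
    rw [hm1, eval_map, eval₂_C_X] at hroot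
    rw [hroot] at hm1
    simp at hm1
    exact hmm.ne_zero hm1
  obtain ⟨i, hi⟩ := hex
  have hci := hcoefdeg i
  have hcg : (m.coeff i).natDegree = g := by
    have := Nat.le_of_dvd hi (hBdeg _ (hcoefB i) hi)
    omega
  obtain ⟨x', hx'⟩ := mem_adjoin_of_dvd hBdeg (hcoefB i) hcg hgpos _ x le_rfl hdx
  obtain ⟨y', hy'⟩ := mem_adjoin_of_dvd hBdeg (hcoefB i) hcg hgpos _ y le_rfl hdy
  exact ⟨_, x', y', hcg, hx', hy'⟩
end USB

namespace USB

theorem engstrom {K : Type*} [Field K] [CharZero K] {A B x y : K[X]}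
    (hxd : 0 < x.natDegree) (hyd : 0 < y.natDegree)
    (hA : 0 < A.natDegree) (h : A.comp x = B.comp y) :
    ∃ c x' y' : K[X], c.natDegree = Nat.gcd x.natDegree y.natDegree ∧ x = x'.comp c ∧
      y = y'.comp c := by
  have key : ∀ w : K[X], 0 < w.natDegree → ∃ a : K, a ≠ 0 ∧ (C a⁻¹ * w).Monic ∧
      (C a⁻¹ * w).natDegree = w.natDegree ∧ w = C a * (C a⁻¹ * w) := by
    intro w hw
    have hw0 : w ≠ 0 := by rintro rfl; simp at hw
    refine ⟨w.leadingCoeff, leadingCoeff_ne_zero.2 hw0, ?_, ?_, ?_⟩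
    · rw [mul_comm]; exact monic_mul_leadingCoeff_inv hw0
    · exact natDegree_C_mul (inv_ne_zero (leadingCoeff_ne_zero.2 hw0))
    · rw [← mul_assoc, ← C_mul, mul_inv_cancel₀ (leadingCoeff_ne_zero.2 hw0)]; simp
  have hB : 0 < B.natDegree := by
    have := congrArg natDegree h
    rw [natDegree_comp, natDegree_comp] at this
    rcases Nat.eq_zero_or_pos B.natDegree with h0 | h0
    · rw [h0] at this
      have : 0 < A.natDegree * x.natDegree := Nat.mul_pos hA hxd
      omega
    · exact h0
  obtain ⟨a, ha, hxm, hxn, hx⟩ := key x hxd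
  obtain ⟨b, hb, hym, hyn, hy⟩ := key y hyd
  have e1 : ∀ (u : K) (w : K[X]), (C u * X : K[X]).comp w = C u * w := by intros; simp
  obtain ⟨c, x', y', h1, h2, h3⟩ := engstrom_core (A := A.comp (C a * X)) (B := B.comp (C b * X))
    hxm hym (by rw [hxn]; exact hxd) (by rw [hyn]; exact hyd)
    (by rw [natDegree_comp, natDegree_C_mul_X _ ha]; simpa using hA)
    (by rw [natDegree_comp, natDegree_C_mul_X _ hb]; simpa using hB)
    (by rw [comp_assoc, comp_assoc, e1, e1, ← hx, ← hy, h])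
  rw [hxn, hyn] at h1
  refine ⟨c, C a * x', C b * y', h1, ?_, ?_⟩
  · rw [mul_comp, C_comp, ← h2, ← hx]
  · rw [mul_comp, C_comp, ← h3, ← hy]

theorem lin_form {K : Type*} [Field K] {l : K[X]} (h : l.natDegree = 1) :
    ∃ a b : K, a ≠ 0 ∧ l = C a * X + C b := by
  obtain ⟨a, ha, b, hb⟩ := natDegree_eq_one.1 h
  exact ⟨a, b, ha, hb.symm⟩

theorem lin_natDegree {K : Type*} [Field K] {a : K} (b : K) (ha : a ≠ 0) :
    (C a * X + C b).natDegree = 1 := natDegree_linear ha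

theorem lin_inv {K : Type*} [Field K] {l : K[X]} (h : l.natDegree = 1) :
    ∃ li : K[X], li.natDegree = 1 ∧ l.comp li = X ∧ li.comp l = X := by
  obtain ⟨a, b, ha, rfl⟩ := lin_form h
  refine ⟨C a⁻¹ * X + C (-(a⁻¹ * b)), natDegree_linear (inv_ne_zero ha), ?_, ?_⟩
  · simp only [add_comp, mul_comp, C_comp, X_comp, mul_add, ← mul_assoc, ← C_mul, mul_inv_cancel₀ ha,
      C_1, one_mul, add_assoc, ← C_add]
    simp [mul_inv_cancel_left₀ ha]
  · simp only [add_comp, mul_comp, C_comp, X_comp, mul_add, ← mul_assoc, ← C_mul, inv_mul_cancel₀ ha,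
      C_1, one_mul, add_assoc, ← C_add]
    simp

theorem linConj_of {K : Type*} [Field K] {f g l li : K[X]} (h1 : l.natDegree = 1)
    (h2 : li.natDegree = 1) (h3 : l.comp li = X) (h4 : li.comp l = X)
    (h : f = l.comp (g.comp li)) : LinConj f g :=
  ⟨l, li, (degree_eq_iff_natDegree_eq_of_pos one_pos).2 h1,
    (degree_eq_iff_natDegree_eq_of_pos one_pos).2 h2, h3, h4, h⟩

theorem linConj_of' {K : Type*} [Field K] {f g l : K[X]} (h1 : l.natDegree = 1)
    (h : f.comp l = l.comp g) : LinConj f g := by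
  obtain ⟨li, h2, h3, h4⟩ := lin_inv h1
  refine linConj_of h1 h2 h3 h4 ?_
  rw [← comp_assoc, ← h, comp_assoc, h3, comp_X]

theorem comp_right_cancel {K : Type*} [Field K] {a b h : K[X]} (hh : 0 < h.natDegree)
    (e : a.comp h = b.comp h) : a = b := by
  have h0 : (a - b).comp h = 0 := by rw [sub_comp, e, sub_self]
  rcases comp_eq_zero_iff.1 h0 with h1 | ⟨_, h1⟩
  · exact sub_eq_zero.1 h1
  · rw [h1] at hh; simp at hh

theorem right_factor {K : Type*} [Field K] [CharZero K] {A B x y : K[X]}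
    (hxd : 0 < x.natDegree) (hyd : 0 < y.natDegree)
    (hA : 0 < A.natDegree) (h : A.comp x = B.comp y) (hd : x.natDegree ∣ y.natDegree) :
    ∃ b : K[X], y = b.comp x := by
  obtain ⟨c, x', y', h1, h2, h3⟩ := engstrom hxd hyd hA h
  rw [Nat.gcd_eq_left hd] at h1
  have h4 : x'.natDegree = 1 := by
    have := congrArg natDegree h2
    rw [natDegree_comp, h1] at this
    exact Nat.eq_of_mul_eq_mul_right hxd (by omega)
  obtain ⟨li, -, h5, h6⟩ := lin_inv h4
  refine ⟨y'.comp li, ?_⟩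
  rw [h2]
  rw [comp_assoc, ← comp_assoc li, h6, X_comp, ← h3]

theorem left_cancel {K : Type*} [Field K] [CharZero K] {p a b : K[X]}
    (hp : 0 < p.natDegree) (hb : 0 < b.natDegree) (hab : a.natDegree = b.natDegree)
    (h : p.comp a = p.comp b) :
    ∃ l : K[X], l.natDegree = 1 ∧ a = l.comp b ∧ p.comp l = p := by
  obtain ⟨l, hl⟩ := right_factor (x := b) (y := a) hb (hab ▸ hb) hp h.symm (hab ▸ dvd_rfl)
  refine ⟨l, ?_, hl, ?_⟩
  · have := congrArg natDegree hl
    rw [natDegree_comp, hab] at this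
    exact Nat.eq_of_mul_eq_mul_right hb (by omega)
  · apply comp_right_cancel hb
    rw [comp_assoc, ← hl, h]

section iter
variable {K : Type*} [Field K]

theorem it_zero (f : K[X]) : polyIter f 0 = X := rfl
theorem it_succ (f : K[X]) (n : ℕ) : polyIter f (n+1) = f.comp (polyIter f n) := rfl
theorem it_one (f : K[X]) : polyIter f 1 = f := by rw [it_succ, it_zero, comp_X]
theorem it_add (f : K[X]) (m n : ℕ) : polyIter f (m+n) = (polyIter f m).comp (polyIter f n) := by
  induction m with
  | zero => rw [zero_add, it_zero, X_comp]
  | succ m ih => rw [Nat.succ_add_eq_add_succ, Nat.add_succ, it_succ, it_succ, ih, comp_assoc]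
theorem it_succ' (f : K[X]) (n : ℕ) : polyIter f (n+1) = (polyIter f n).comp f := by
  rw [it_add, it_one]
theorem it_natDegree (f : K[X]) (n : ℕ) : (polyIter f n).natDegree = f.natDegree ^ n := by
  induction n with
  | zero => simp [it_zero]
  | succ n ih => rw [it_succ, natDegree_comp, ih, pow_succ, mul_comm]
theorem it_semi {f p e : K[X]} (h : f.comp p = p.comp e) (n : ℕ) :
    (polyIter f n).comp p = p.comp (polyIter e n) := by
  induction n with
  | zero => simp [it_zero]
  | succ n ih => rw [it_succ, comp_assoc, ih, ← comp_assoc, h, comp_assoc, it_succ]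
theorem it_mul (f : K[X]) (m n : ℕ) : polyIter f (m*n) = polyIter (polyIter f m) n := by
  induction n with
  | zero => rfl
  | succ n ih => rw [Nat.mul_succ, add_comm, it_add, ih, it_succ]
end iter
end USB

namespace USB

theorem surj {K : Type*} [Field K] [IsAlgClosed K] {a b c d : K[X]} {m n : ℕ}
    (hb : b.natDegree = m) (hc : c.natDegree = m) (hd : d.natDegree = n)
    (hm : 0 < m) (hmn : Nat.Coprime m n) (h : a.comp b = c.comp d) {x0 y0 : K}
    (h0 : a.eval x0 = c.eval y0) : ∃ t, b.eval t = x0 ∧ d.eval t = y0 := by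
  let Φ : K[X][X] →+* K[X] := eval₂RingHom (compRingHom b) d
  let ψ : K[X][X] →+* K := eval₂RingHom (evalRingHom x0) y0
  have hΦC : ∀ q : K[X], Φ (C q) = q.comp b := by intro q; simp [Φ]
  have hΦX : Φ X = d := by simp [Φ]
  have hψC : ∀ q : K[X], ψ (C q) = q.eval x0 := by intro q; simp [ψ]
  have hψX : ψ X = y0 := by simp [ψ]
  have hc0 : c ≠ 0 := by rintro rfl; simp at hc; omega
  have hb0 : b ≠ 0 := by rintro rfl; simp at hb; omega
  have hlc : c.leadingCoeff ≠ 0 := leadingCoeff_ne_zero.2 hc0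
  set w : K[X][X] := (C (c.leadingCoeff)⁻¹ * c).map C - C (C (c.leadingCoeff)⁻¹ * a) with hw
  have hmon : (C (c.leadingCoeff)⁻¹ * c).Monic := by
    rw [mul_comm]; exact monic_mul_leadingCoeff_inv hc0
  have hnd : (C (c.leadingCoeff)⁻¹ * c).natDegree = m := by
    rw [natDegree_C_mul (inv_ne_zero hlc), hc]
  have hmon' : ((C (c.leadingCoeff)⁻¹ * c).map (C : K →+* K[X])).Monic := hmon.map _
  have hwm : w.Monic := by
    apply hmon'.sub_of_left
    refine degree_C_le.trans_lt ?_
    rw [← natDegree_pos_iff_degree_pos, hmon.natDegree_map, hnd]; exact hm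
  have hwd : w.natDegree = m := by
    rw [hw, natDegree_sub_C, hmon.natDegree_map, hnd]
  have hev : ∀ (q : K[X]), Φ (q.map C) = q.comp d := by
    intro q
    simp only [Φ, coe_eval₂RingHom, eval₂_map, comp]
    congr 1
    ext k : 1
    simp
  have hev' : ∀ (q : K[X]), ψ (q.map C) = q.eval y0 := by
    intro q
    simp only [ψ, coe_eval₂RingHom, eval₂_map]
    rw [eval]
    congr 1
    ext k : 1
    simp
  have hΦw : Φ w = 0 := by
    rw [hw, map_sub, hev, hΦC, mul_comp, mul_comp, C_comp, C_comp, h, sub_self]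
  have hψw : ψ w = 0 := by
    rw [hw, map_sub, hev', hψC]; simp [h0]
  have hker : ∀ q, Φ q = 0 → ψ q = 0 := by
    intro q hq
    have hdiv := modByMonic_add_div q w
    set r := q %ₘ w with hr
    have hrd : r.degree < m := by
      have := degree_modByMonic_lt q hwm
      rwa [degree_eq_natDegree hwm.ne_zero, hwd] at this
    have hΦr : Φ r = 0 := by
      have := congrArg Φ hdiv
      rw [map_add, map_mul, hΦw, zero_mul, add_zero, hq] at this
      exact this
    suffices hr0 : r = 0 by
      rw [← hdiv, map_add, map_mul, hψw, hr0]; simp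
    have hs : Φ r = ∑ i ∈ Finset.range m, (r.coeff i).comp b * d ^ i := by
      rw [show Φ r = eval₂ (compRingHom b) d r from rfl, eval₂_eq_sum_range' _ (n := m)]
      · simp
      · rcases eq_or_ne r 0 with h | h
        · rw [h]; simpa using hm
        · exact (natDegree_lt_iff_degree_lt h).2 hrd
    have hd0 : ∀ i < m, d ^ i ≠ 0 := by
      intro i hi
      rcases Nat.eq_zero_or_pos i with h1 | h1
      · simp [h1]
      · apply pow_ne_zero
        rintro rfl
        simp at hd
        rw [← hd, Nat.coprime_zero_right] at hmn
        omega
    have hdeg : ∀ i < m, r.coeff i ≠ 0 → ((r.coeff i).comp b * d ^ i) ≠ 0 ∧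
        ((r.coeff i).comp b * d ^ i).natDegree = (r.coeff i).natDegree * m + i * n := by
      intro i hi h1
      have h2 : (r.coeff i).comp b ≠ 0 := by
        intro h3
        rcases comp_eq_zero_iff.1 h3 with h4 | ⟨_, h4⟩
        · exact h1 h4
        · rw [h4] at hb; simp at hb; omega
      refine ⟨mul_ne_zero h2 (hd0 i hi), ?_⟩
      rw [natDegree_mul h2 (hd0 i hi), natDegree_comp, hb, natDegree_pow, hd]
    have hz := degree_sum_eq_of_disjoint (fun i => (r.coeff i).comp b * d ^ i) (Finset.range m) (by
      rintro i ⟨hi, hi0⟩ j ⟨hj, hj0⟩ hij hdij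
      rw [Finset.mem_range] at hi hj
      have hi1 : r.coeff i ≠ 0 := by intro h; apply hi0; simp [h]
      have hj1 : r.coeff j ≠ 0 := by intro h; apply hj0; simp [h]
      have h1 := natDegree_eq_of_degree_eq hdij
      simp only [(hdeg i hi hi1).2, (hdeg j hj hj1).2] at h1
      have h2 : i * n ≡ j * n [MOD m] := by
        have := congrArg (· % m) h1
        simpa [Nat.ModEq, Nat.mul_add_mod', Nat.add_mod] using this
      have h3 := Nat.ModEq.cancel_right_of_coprime (by simpa using hmn) h2
      rw [Nat.ModEq, Nat.mod_eq_of_lt hi, Nat.mod_eq_of_lt hj] at h3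
      exact hij h3)
    rw [← hs, hΦr, degree_zero] at hz
    ext i : 1
    rcases lt_or_ge i m with hi | hi
    · by_contra h1
      have h2 := (Finset.sup_eq_bot_iff _ _).1 hz.symm i (Finset.mem_range.2 hi)
      rw [degree_eq_bot] at h2
      exact (hdeg i hi (by simpa using h1)).1 h2
    · rw [coeff_zero]
      exact coeff_eq_zero_of_degree_lt (hrd.trans_le (by exact_mod_cast hi))
  have hIntg : Φ.IsIntegral := by
    intro q
    have hX : Φ.IsIntegralElem X := by
      refine ⟨(C (b.leadingCoeff)⁻¹ * b).map (C.comp C) - C (C (C (b.leadingCoeff)⁻¹ * X)), ?_, ?_⟩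
      · have hmon : (C (b.leadingCoeff)⁻¹ * b).Monic := by
          rw [mul_comm]; exact monic_mul_leadingCoeff_inv hb0
        apply (hmon.map _).sub_of_left
        refine degree_C_le.trans_lt ?_
        rw [← natDegree_pos_iff_degree_pos, hmon.natDegree_map,
          natDegree_C_mul (inv_ne_zero (leadingCoeff_ne_zero.2 hb0)), hb]; exact hm
      · rw [eval₂_sub, eval₂_map, eval₂_C, hΦC]
        have : Φ.comp (C.comp C) = C := by
          ext k : 1
          rw [RingHom.comp_apply, RingHom.comp_apply, hΦC, C_comp]
        rw [this, eval₂_C_X]; simp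
    induction q using Polynomial.induction_on' with
    | add p q hp hq => exact hp.add _ hq
    | monomial k a =>
      rw [← C_mul_X_pow_eq_monomial]
      have hC : Φ.IsIntegralElem (C a) := by
        have := Φ.isIntegralElem_map (x := C (C a))
        rwa [hΦC, C_comp] at this
      have hp : ∀ k, Φ.IsIntegralElem (X ^ k) := by
        intro k
        induction k with
        | zero => simpa using Φ.isIntegralElem_one
        | succ k ih => rw [pow_succ]; exact ih.mul _ hX
      exact hC.mul _ (hp k)
  let _ : Algebra K[X][X] K[X] := Φ.toAlgebra
  have : Algebra.IsIntegral K[X][X] K[X] := ⟨hIntg⟩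
  have hpr : (RingHom.ker ψ).IsPrime := RingHom.ker_isPrime ψ
  obtain ⟨Q, -, hQp, hQ⟩ := Ideal.exists_ideal_over_prime_of_isIntegral (S := K[X])
    (RingHom.ker ψ) ⊥ (by
      intro q hq
      rw [RingHom.mem_ker]
      exact hker q (by rw [Ideal.mem_comap, Ideal.mem_bot] at hq; exact hq))
  have hmem : ∀ q, ψ q = 0 → Φ q ∈ Q := by
    intro q hq
    have : q ∈ Q.comap (algebraMap K[X][X] K[X]) := by rw [hQ]; exact hq
    exact this
  have hbQ : b - C x0 ∈ Q := by
    have := hmem (C (X - C x0)) (by rw [hψC]; simp)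
    rw [hΦC] at this; simpa using this
  have hdQ : d - C y0 ∈ Q := by
    have := hmem (X - C (C y0)) (by rw [map_sub, hψX, hψC]; simp)
    rw [map_sub, hΦC, hΦX] at this; simpa using this
  obtain ⟨g, hg⟩ := (IsPrincipalIdealRing.principal Q).principal
  have hg' : ∀ q, q ∈ Q → g ∣ q := by
    intro q hq; rw [hg] at hq; exact Ideal.mem_span_singleton.1 hq
  have hg0 : g.degree ≠ 0 := by
    intro h1
    apply hQp.ne_top
    rw [hg]
    exact Ideal.span_singleton_eq_top.2 (isUnit_iff_degree_eq_zero.2 h1)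
  obtain ⟨t, ht⟩ := IsAlgClosed.exists_root g hg0
  refine ⟨t, ?_, ?_⟩
  · have := (ht.dvd (hg' _ hbQ))
    simpa [sub_eq_zero] using this
  · have := (ht.dvd (hg' _ hdQ))
    simpa [sub_eq_zero] using this
end USB

namespace USB

/-- critical values -/
def CVs {K : Type*} [Field K] (p : K[X]) : Set K :=
  {v | ∃ y, p.derivative.eval y = 0 ∧ p.eval y = v}

theorem star {K : Type*} [Field K] [IsAlgClosed K] {f p p1 c : K[X]}
    (hp : 0 < p.natDegree) (h1 : p1.natDegree = p.natDegree)
    (hco : Nat.Coprime p.natDegree c.natDegree) (h : f.comp p1 = p.comp c)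
    {v x0 : K} (hv : v ∈ CVs p) (hx : f.eval x0 = v) :
    f.derivative.eval x0 = 0 ∨ x0 ∈ CVs p1 := by
  obtain ⟨y0, hy0, hy1⟩ := hv
  obtain ⟨t, ht1, ht2⟩ := surj h1 rfl rfl hp hco h (x0 := x0) (y0 := y0) (by rw [hx, hy1])
  have hd := congrArg (fun q => eval t (derivative q)) h
  simp only [derivative_comp, eval_mul, eval_comp, ht1, ht2, hy0, mul_zero] at hd
  rcases mul_eq_zero.1 hd with h2 | h2
  · exact Or.inr ⟨t, h2, ht1⟩
  · exact Or.inl h2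

theorem rh_dvd {K : Type*} [Field K] [CharZero K] [IsAlgClosed K] {f : K[X]}
    (hf : 0 < f.natDegree) (A A' : Finset K)
    (h : ∀ x, f.eval x ∈ A → f.derivative.eval x = 0 ∨ x ∈ A') :
    (∏ v ∈ A, (f - C v)) ∣ (∏ x ∈ A', (X - C x)) * f.derivative ^ 2 := by
  classical
  have hf' : derivative f ≠ 0 := fun h0 => hf.ne' (derivative_eq_zero.1 h0)
  have hP : (∏ x ∈ A', (X - C x)) ≠ 0 := (monic_prod_of_monic _ _ (fun i _ => monic_X_sub_C i)).ne_zero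
  apply Finset.prod_dvd_of_coprime
  · intro v _ w _ hvw
    have h1 : IsCoprime (X - C v) (X - C w) :=
      isCoprime_X_sub_C_of_isUnit_sub (sub_ne_zero.2 hvw).isUnit
    have h2 := h1.map (compRingHom f)
    simpa using h2
  · intro v hv
    have hfv : f - C v ≠ 0 := by
      intro h0
      have := natDegree_sub_C (p := f) (a := v)
      rw [h0, natDegree_zero] at this; omega
    rw [IsAlgClosed.dvd_iff_roots_le_roots hfv (mul_ne_zero hP (pow_ne_zero _ hf')),
      Multiset.le_iff_count]
    intro x
    rw [count_roots, count_roots, rootMultiplicity_mul (mul_ne_zero hP (pow_ne_zero _ hf')),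
      ← count_roots (derivative f ^ 2), roots_pow, Multiset.count_nsmul, count_roots]
    by_cases hr : (f - C v).IsRoot x
    · have h1 := derivative_rootMultiplicity_of_root hr
      rw [derivative_sub, derivative_C, sub_zero] at h1
      have h2 : 0 < rootMultiplicity x (f - C v) := (rootMultiplicity_pos hfv).2 hr
      have hfx : f.eval x = v := by simpa [IsRoot, sub_eq_zero] using hr
      rw [h1]
      rcases h x (hfx ▸ hv) with h3 | h3
      · have h4 : 0 < rootMultiplicity x (derivative f) := (rootMultiplicity_pos hf').2 h3
        omega
      · have h4 : 0 < rootMultiplicity x (∏ x ∈ A', (X - C x)) := by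
          rw [rootMultiplicity_pos hP, IsRoot, eval_prod]
          exact Finset.prod_eq_zero h3 (by simp)
        omega
    · rw [rootMultiplicity_eq_zero hr]; omega

theorem natDegree_prod_sub {K : Type*} [Field K] {f : K[X]} (hf : 0 < f.natDegree)
    (A : Finset K) : (∏ v ∈ A, (f - C v)).natDegree = A.card * f.natDegree := by
  rw [natDegree_prod]
  · simp [natDegree_sub_C]
  · intro v _ h0
    have := natDegree_sub_C (p := f) (a := v)
    rw [h0, natDegree_zero] at this; omega

theorem rh_card {K : Type*} [Field K] [CharZero K] [IsAlgClosed K] {f : K[X]}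
    (hf : 0 < f.natDegree) (A A' : Finset K)
    (h : ∀ x, f.eval x ∈ A → f.derivative.eval x = 0 ∨ x ∈ A') :
    A.card * f.natDegree ≤ A'.card + 2 * (f.natDegree - 1) := by
  have hf' : derivative f ≠ 0 := fun h0 => hf.ne' (derivative_eq_zero.1 h0)
  have hP : (∏ x ∈ A', (X - C x)) ≠ 0 := (monic_prod_of_monic _ _ (fun i _ => monic_X_sub_C i)).ne_zero
  have h1 := natDegree_le_of_dvd (rh_dvd hf A A' h) (mul_ne_zero hP (pow_ne_zero _ hf'))
  rw [natDegree_prod_sub hf, natDegree_mul hP (pow_ne_zero _ hf'), natDegree_pow,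
    natDegree_derivative, natDegree_prod_sub (f := X) (by simp)] at h1
  simpa using h1

theorem rh_eq {K : Type*} [Field K] [CharZero K] [IsAlgClosed K] {f : K[X]}
    (hf : 0 < f.natDegree) {v1 v2 : K} (hv : v1 ≠ v2)
    (h : ∀ x, f.eval x = v1 ∨ f.eval x = v2 → f.derivative.eval x = 0 ∨ x = v1 ∨ x = v2) :
    C ((f.natDegree : K) ^ 2) * ((f - C v1) * (f - C v2)) =
      (X - C v1) * (X - C v2) * f.derivative ^ 2 := by
  classical
  have hf' : derivative f ≠ 0 := fun h0 => hf.ne' (derivative_eq_zero.1 h0)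
  have h1 := rh_dvd hf {v1, v2} {v1, v2} (by simpa using h)
  rw [Finset.prod_pair hv, Finset.prod_pair hv] at h1
  have hne : ∀ v, f - C v ≠ 0 := by
    intro v h0
    have := natDegree_sub_C (p := f) (a := v)
    rw [h0, natDegree_zero] at this; omega
  have hlcf : ∀ v, (f - C v).leadingCoeff = f.leadingCoeff := by
    intro v
    rw [leadingCoeff_sub_of_degree_lt]
    exact degree_C_le.trans_lt (natDegree_pos_iff_degree_pos.1 hf)
  have hlc' : (derivative f).leadingCoeff = f.leadingCoeff * f.natDegree := by
    rw [leadingCoeff, natDegree_derivative, coeff_derivative, Nat.sub_add_cancel hf,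
      leadingCoeff, Nat.cast_sub hf]
    push_cast; ring
  set P := (f - C v1) * (f - C v2) with hP
  set Q := (X - C v1) * (X - C v2) * f.derivative ^ 2 with hQ
  have hP0 : P ≠ 0 := mul_ne_zero (hne _) (hne _)
  have hQ0 : Q ≠ 0 := mul_ne_zero (mul_ne_zero (X_sub_C_ne_zero _) (X_sub_C_ne_zero _))
    (pow_ne_zero _ hf')
  have hdP : P.natDegree = 2 * f.natDegree := by
    rw [hP, natDegree_mul (hne _) (hne _), natDegree_sub_C, natDegree_sub_C]; ring
  have hdQ : Q.natDegree = 2 * f.natDegree := by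
    rw [hQ, natDegree_mul (mul_ne_zero (X_sub_C_ne_zero _) (X_sub_C_ne_zero _))
      (pow_ne_zero _ hf'), natDegree_mul (X_sub_C_ne_zero _) (X_sub_C_ne_zero _), natDegree_pow,
      natDegree_derivative]
    simp; omega
  obtain ⟨R, hR⟩ := h1
  have hR0 : R ≠ 0 := by rintro rfl; rw [mul_zero] at hR; exact hQ0 hR
  have hRd : R.natDegree = 0 := by
    have := congrArg natDegree hR
    rw [natDegree_mul hP0 hR0] at this; omega
  obtain ⟨r, rfl⟩ := natDegree_eq_zero.1 hRd
  have hl := congrArg leadingCoeff hR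
  rw [leadingCoeff_mul P, leadingCoeff_C, hP, hQ, leadingCoeff_mul, leadingCoeff_mul,
    leadingCoeff_mul, leadingCoeff_pow, hlcf, hlcf, hlc', leadingCoeff_X_sub_C,
    leadingCoeff_X_sub_C] at hl
  have hfl : f.leadingCoeff ≠ 0 := leadingCoeff_ne_zero.2 (by rintro rfl; simp at hf)
  have : r = (f.natDegree : K) ^ 2 := by
    apply mul_left_cancel₀ (mul_ne_zero hfl hfl)
    rw [← hl]; ring
  rw [hR, ← this, mul_comm]

theorem coeff_X_mul_deriv {K : Type*} [Field K] (p : K[X]) (j : ℕ) :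
    (X * derivative p).coeff j = j * p.coeff j := by
  cases j with
  | zero => simp
  | succ j => rw [coeff_X_mul, coeff_derivative]; push_cast; ring

theorem ode_unique {K : Type*} [Field K] [CharZero K] {h : K[X]} {n : ℕ}
    (hn : h.natDegree ≠ n)
    (e : (X ^ 2 - 1) * derivative (derivative h) + X * derivative h = C ((n : K) ^ 2) * h) :
    h = 0 := by
  by_contra h0
  have e2 : X * derivative (X * derivative h) - derivative (derivative h) = C ((n : K) ^ 2) * h := by
    rw [← e, derivative_mul, derivative_X]; ring
  have e3 := congrArg (fun q => q.coeff h.natDegree) e2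
  simp only [coeff_sub, coeff_X_mul_deriv, coeff_C_mul] at e3
  rw [coeff_derivative, coeff_derivative, coeff_eq_zero_of_natDegree_lt (n := h.natDegree + 1 + 1)
    (by omega)] at e3
  have hl : h.coeff h.natDegree ≠ 0 := leadingCoeff_ne_zero.2 h0
  have e4 : (h.natDegree : K) ^ 2 = (n : K) ^ 2 := by
    apply mul_right_cancel₀ hl
    rw [← e3]; ring
  have e5 : h.natDegree ^ 2 = n ^ 2 := by exact_mod_cast e4
  exact hn (Nat.pow_left_injective (n := 2) (by norm_num) e5)

theorem ode_T {K : Type*} [Field K] [CharZero K] {g : K[X]} (hg : 0 < g.natDegree)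
    (e : C ((g.natDegree : K) ^ 2) * (g ^ 2 - 1) = (X ^ 2 - 1) * derivative g ^ 2) :
    g = Chebyshev.T K g.natDegree ∨ g = - Chebyshev.T K g.natDegree := by
  set n := g.natDegree with hn
  set T := Chebyshev.T K n with hT
  have hg' : derivative g ≠ 0 := fun h0 => hg.ne' (derivative_eq_zero.1 h0)
  have e1 : (X ^ 2 - 1) * derivative (derivative g) + X * derivative g = C ((n : K) ^ 2) * g := by
    have h1 := congrArg derivative e
    simp only [derivative_mul, derivative_C, derivative_sub, derivative_pow, derivative_one,
      derivative_X] at h1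
    have h2 : (2 * derivative g) * ((X ^ 2 - 1) * derivative (derivative g) + X * derivative g) =
      (2 * derivative g) * (C ((n : K) ^ 2) * g) := by
      simp at h1
      rw [show (C 2 : K[X]) = 2 from rfl] at h1
      simp only [map_pow, C_eq_natCast]
      linear_combination -h1
    exact mul_left_cancel₀ (mul_ne_zero two_ne_zero hg') h2
  have e2 : (X ^ 2 - 1) * derivative (derivative T) + X * derivative T = C ((n : K) ^ 2) * T := by
    have h1 := Chebyshev.one_sub_X_sq_mul_derivative_derivative_T_eq_poly_in_T (R := K) n
    simp only [Function.iterate_succ, Function.iterate_zero, Function.comp_apply, id] at h1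
    simp only [map_pow, C_eq_natCast]
    push_cast at h1
    linear_combination -h1
  have hTd : T.natDegree = n := by rw [hT, Chebyshev.natDegree_T]; simp
  have hT0 : T ≠ 0 := by intro h; rw [h] at hTd; simp at hTd; omega
  set lam := g.leadingCoeff / T.leadingCoeff with hlam
  have hz : g - C lam * T = 0 := by
    by_contra hne
    refine hne (ode_unique (n := n) ?_ ?_)
    · intro hd
      apply hne
      rw [← leadingCoeff_eq_zero, leadingCoeff, hd, coeff_sub, coeff_C_mul]
      have h1 : g.coeff n = g.leadingCoeff := rfl
      have h2 : T.coeff n = T.leadingCoeff := by rw [leadingCoeff, hTd]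
      rw [h1, h2, hlam, div_mul_cancel₀ _ (leadingCoeff_ne_zero.2 hT0), sub_self]
    · simp only [derivative_sub, derivative_C_mul]
      linear_combination e1 - C lam * e2
  have hgl : g = C lam * T := sub_eq_zero.1 hz
  have h1 := congrArg (eval 1) e
  have hn0 : (n : K) ≠ 0 := by exact_mod_cast hg.ne'
  simp [hn0, sub_eq_zero] at h1
  have h2 : eval 1 g = lam := by
    rw [hgl, eval_mul, eval_C, hT, Chebyshev.T_eval_one, mul_one]
  rw [h2] at h1
  rcases h1 with h1 | h1
  · left; rw [hgl, h1]; simp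
  · right; rw [hgl, h1]; simp

theorem cheb_conj {K : Type*} [Field K] [CharZero K] {f : K[X]}
    (hf : 0 < f.natDegree) {v1 v2 : K} (hv : v1 ≠ v2)
    (e : C ((f.natDegree : K) ^ 2) * ((f - C v1) * (f - C v2)) =
      (X - C v1) * (X - C v2) * f.derivative ^ 2) :
    LinConj f (cheb K f.natDegree) ∨ LinConj f (-(cheb K f.natDegree)) := by
  set m : K := (v1 - v2) / 2 with hm
  set n : K := (v1 + v2) / 2 with hn
  have hm0 : m ≠ 0 := div_ne_zero (sub_ne_zero.2 hv) two_ne_zero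
  have hv1 : v1 = m + n := by rw [hm, hn]; ring
  have hv2 : v2 = n - m := by rw [hm, hn]; ring
  set l : K[X] := C m * X + C n with hl
  have hld : l.natDegree = 1 := natDegree_linear hm0
  obtain ⟨li, hlid, h1, h2⟩ := lin_inv hld
  set g := li.comp (f.comp l) with hg
  have hfl : f.comp l = C m * g + C n := by
    have : l.comp g = f.comp l := by rw [hg, ← comp_assoc, h1, X_comp]
    rw [← this, hl]; simp
  have hgd : g.natDegree = f.natDegree := by
    rw [hg, natDegree_comp, natDegree_comp, hlid, hld]; ring
  have hfd : (derivative f).comp l = derivative g := by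
    have h3 := congrArg derivative hfl
    rw [derivative_comp, hl] at h3
    simp only [derivative_add, derivative_mul, derivative_C, derivative_X] at h3
    apply mul_left_cancel₀ (C_ne_zero.2 hm0)
    linear_combination h3
  have e2 := congrArg (fun q => q.comp l) e
  simp only [mul_comp, sub_comp, C_comp, X_comp, pow_comp, hfd, hfl] at e2
  have e3 : C ((g.natDegree : K) ^ 2) * (g ^ 2 - 1) = (X ^ 2 - 1) * derivative g ^ 2 := by
    apply mul_left_cancel₀ (pow_ne_zero 2 (C_ne_zero.2 hm0))
    rw [hgd]
    rw [hv1, hv2, hl] at e2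
    simp only [C_add, C_sub] at e2
    linear_combination e2
  have hT := ode_T (hgd ▸ hf) e3
  rw [hgd] at hT
  set l' : K[X] := C (m / 2) * X + C n with hl'
  have hl'd : l'.natDegree = 1 := natDegree_linear (div_ne_zero hm0 two_ne_zero)
  have hs : (2 * X : K[X]).natDegree = 1 := by
    have := natDegree_C_mul_X (2 : K) two_ne_zero
    simpa using this
  have hch : (cheb K f.natDegree).comp (2 * X) = 2 * Chebyshev.T K f.natDegree := by
    rw [cheb, dickson_one_one_eq_chebyshev_C, Chebyshev.C_comp_two_mul_X]
  have hls : l'.comp (2 * X) = l := by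
    rw [hl', hl]
    have : C (m / 2) * 2 = C m := by
      rw [show (2 : K[X]) = C 2 from rfl, ← C_mul]; congr 1; field_simp
    simp only [add_comp, mul_comp, C_comp, X_comp, ← mul_assoc, this]
  have key : ∀ w : K[X], w.comp (2 * X) = 2 * g → LinConj f w := by
    intro w hw
    apply linConj_of' hl'd
    apply comp_right_cancel (h := 2 * X) (by omega)
    rw [comp_assoc, hls, comp_assoc, hw, hfl, hl']
    have : C (m / 2) * 2 = C m := by
      rw [show (2 : K[X]) = C 2 from rfl, ← C_mul]; congr 1; field_simp
    simp only [add_comp, mul_comp, C_comp, X_comp, ← mul_assoc, this]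
  rcases hT with hT | hT
  · left; apply key; rw [hch, ← hT]
  · right; apply key; rw [neg_comp, hch, hT]; ring

end USB

namespace USB
variable {K : Type*} [Field K] [CharZero K] [IsAlgClosed K]

/-- `p` of degree coprime to `deg f` semiconjugates something to `f^N`. -/
def CP {K : Type*} [Field K] (f : K[X]) (N : ℕ) (p : K[X]) : Prop :=
  0 < p.natDegree ∧ Nat.Coprime p.natDegree f.natDegree ∧ ∃ η, (polyIter f N).comp p = p.comp η

theorem semi_natDegree {F p e : K[X]} (hp : 0 < p.natDegree) (h : F.comp p = p.comp e) :
    e.natDegree = F.natDegree := by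
  have := congrArg natDegree h
  rw [natDegree_comp, natDegree_comp, mul_comm] at this
  exact (Nat.eq_of_mul_eq_mul_left hp this).symm

theorem cp_back {f p : K[X]} {N : ℕ} (hN : 1 ≤ N) (hf : 0 < f.natDegree) (h : CP f N p) :
    ∃ p1 c, CP f N p1 ∧ p1.natDegree = p.natDegree ∧ c.natDegree = f.natDegree ∧
      f.comp p1 = p.comp c := by
  obtain ⟨hp, hco, η, hη⟩ := h
  obtain ⟨k, rfl⟩ : ∃ k, N = k + 1 := ⟨N - 1, by omega⟩
  have hηd := semi_natDegree hp hη
  rw [it_natDegree] at hηd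
  have hxd : ((polyIter f k).comp p).natDegree = f.natDegree ^ k * p.natDegree := by
    rw [natDegree_comp, it_natDegree]
  have hδ : 0 < f.natDegree ^ k := pow_pos hf k
  obtain ⟨c0, p1, c, h1, h2, h3⟩ := engstrom (A := f) (B := p) (x := (polyIter f k).comp p) (y := η)
    (by rw [hxd]; positivity) (by rw [hηd]; positivity) hf
    (by rw [← comp_assoc, ← it_succ, hη])
  rw [hxd, hηd, pow_succ, Nat.gcd_mul_left, hco, mul_one] at h1
  have hp1 : p1.natDegree = p.natDegree := by
    have := congrArg natDegree h2
    rw [hxd, natDegree_comp, h1, mul_comm] at this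
    exact (Nat.eq_of_mul_eq_mul_right hδ this).symm
  have hc : c.natDegree = f.natDegree := by
    have := congrArg natDegree h3
    rw [hηd, natDegree_comp, h1, pow_succ, mul_comm] at this
    exact (Nat.eq_of_mul_eq_mul_right hδ this).symm
  refine ⟨p1, c, ⟨by omega, by rwa [hp1], c0.comp c, ?_⟩, hp1, hc, ?_⟩
  · apply comp_right_cancel (h := c0) (by omega)
    rw [comp_assoc, ← h2, comp_assoc, comp_assoc, ← h3, ← comp_assoc p1, ← h2, comp_assoc, ← hη,
      ← comp_assoc, ← comp_assoc, ← it_add, ← it_add, add_comm]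
  · apply comp_right_cancel (h := c0) (by omega)
    rw [comp_assoc, ← h2, comp_assoc, ← h3, ← hη, it_succ, comp_assoc]

theorem cp_forward {f p : K[X]} {N : ℕ} (hN : 1 ≤ N) (hf : 0 < f.natDegree) (h : CP f N p) :
    ∃ p2 c, CP f N p2 ∧ p2.natDegree = p.natDegree ∧ c.natDegree = f.natDegree ∧
      f.comp p = p2.comp c := by
  obtain ⟨hp, hco, η, hη⟩ := h
  obtain ⟨k, rfl⟩ : ∃ k, N = k + 1 := ⟨N - 1, by omega⟩
  have hηd := semi_natDegree hp hη
  rw [it_natDegree] at hηd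
  have hxd : (f.comp p).natDegree = f.natDegree * p.natDegree := by
    rw [natDegree_comp]
  have hδ : 0 < f.natDegree ^ k := pow_pos hf k
  obtain ⟨c0, p2, c, h1, h2, h3⟩ := engstrom (A := polyIter f k) (B := p) (x := f.comp p) (y := η)
    (by rw [hxd]; positivity) (by rw [hηd]; positivity) (by rw [it_natDegree]; exact hδ)
    (by rw [← comp_assoc, ← it_succ', hη])
  have hg : Nat.gcd p.natDegree (f.natDegree ^ k) = 1 := Nat.Coprime.pow_right k hco
  rw [hxd, hηd, pow_succ', Nat.gcd_mul_left, hg, mul_one] at h1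
  have hp2 : p2.natDegree = p.natDegree := by
    have := congrArg natDegree h2
    rw [hxd, natDegree_comp, h1, mul_comm] at this
    exact (Nat.eq_of_mul_eq_mul_right hf this).symm
  refine ⟨p2, c0, ⟨by omega, by rwa [hp2], c0.comp c, ?_⟩, hp2, h1, h2⟩
  apply comp_right_cancel (h := c0) (by omega)
  rw [comp_assoc, ← h2, comp_assoc, comp_assoc, ← h3, ← comp_assoc p2, ← h2, comp_assoc, ← hη,
      ← comp_assoc, ← comp_assoc, ← it_succ', ← it_succ]

theorem CVs_finite {p : K[X]} (hp : 0 < p.natDegree) : (CVs p).Finite := by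
  classical
  have h0 : derivative p ≠ 0 := fun h0 => hp.ne' (derivative_eq_zero.1 h0)
  refine Set.Finite.subset ((derivative p).roots.toFinset.finite_toSet.image (fun y => eval y p)) ?_
  rintro v ⟨y, h1, h2⟩
  exact ⟨y, by simp [h0, h1], h2⟩

theorem cp_two {f : K[X]} {N : ℕ} (hN : 1 ≤ N) (hf : 2 ≤ f.natDegree) {p1 p2 p3 : K[X]}
    (h1 : CP f N p1) (h2 : CP f N p2) (h3 : CP f N p3) {u1 u2 u3 : K} (hu1 : u1 ∈ CVs p1)
    (hu2 : u2 ∈ CVs p2) (hu3 : u3 ∈ CVs p3) : u1 = u2 ∨ u1 = u3 ∨ u2 = u3 := by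
  classical
  by_contra hcon
  push Not at hcon
  set F := polyIter f N with hF
  have hFd : 2 ≤ F.natDegree := by
    rw [hF, it_natDegree]
    calc 2 ≤ f.natDegree := hf
      _ = f.natDegree ^ 1 := (pow_one _).symm
      _ ≤ _ := Nat.pow_le_pow_right (by omega) hN
  set A : Finset K := (CVs_finite h1.1).toFinset ∪ (CVs_finite h2.1).toFinset ∪
    (CVs_finite h3.1).toFinset with hA
  have hst : ∀ p, CP f N p → ∀ x, eval x F ∈ CVs p → eval x (derivative F) = 0 ∨ x ∈ CVs p := by
    rintro p ⟨hp, hco, η, hη⟩ x hx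
    have hηd := semi_natDegree hp hη
    refine star hp rfl ?_ hη hx rfl
    rw [hηd, it_natDegree]; exact Nat.Coprime.pow_right _ hco
  have hc := rh_card (f := F) (by omega) A A (by
    intro x hx
    simp only [hA, Finset.mem_union, Set.Finite.mem_toFinset] at hx ⊢
    rcases hx with (hx | hx) | hx
    · have := hst _ h1 x hx; tauto
    · have := hst _ h2 x hx; tauto
    · have := hst _ h3 x hx; tauto)
  have h3A : 3 ≤ A.card := by
    have hs : ({u1, u2, u3} : Finset K) ⊆ A := by
      intro u hu
      simp only [hA, Finset.mem_union, Set.Finite.mem_toFinset, Finset.mem_insert,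
        Finset.mem_singleton] at hu ⊢
      rcases hu with rfl | rfl | rfl <;> tauto
    have := Finset.card_le_card hs
    rwa [Finset.card_eq_three.2 ⟨u1, u2, u3, hcon.1, hcon.2.1, hcon.2.2, rfl⟩] at this
  obtain ⟨D, hD⟩ : ∃ D, F.natDegree = D + 1 := ⟨F.natDegree - 1, by omega⟩
  rw [hD] at hc
  have : 3 * D ≤ A.card * D := Nat.mul_le_mul_right _ h3A
  rw [Nat.mul_succ] at hc
  simp at hc
  omega

theorem cp_single {f : K[X]} {N : ℕ} (hN : 1 ≤ N) (hf : Disintegrated f) :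
    ∃ v : K, ∀ p, CP f N p → CVs p ⊆ {v} := by
  obtain ⟨hf2, -, hc1, hc2⟩ := hf
  by_contra hcon
  push Not at hcon
  obtain ⟨p1, h1, h1'⟩ := hcon 0
  obtain ⟨u1, hu1, -⟩ := Set.not_subset.1 h1'
  obtain ⟨p2, h2, h2'⟩ := hcon u1
  obtain ⟨u2, hu2, hne⟩ := Set.not_subset.1 h2'
  have hne : u1 ≠ u2 := fun h => hne h.symm
  have hU : ∀ p, CP f N p → ∀ x ∈ CVs p, x = u1 ∨ x = u2 := by
    intro p hp x hx
    rcases cp_two hN hf2 h1 h2 hp hu1 hu2 hx with h | h | h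
    · exact absurd h hne
    · exact Or.inl h.symm
    · exact Or.inr h.symm
  have key : ∀ p, CP f N p → ∀ x, eval x f ∈ CVs p → 
      eval x (derivative f) = 0 ∨ x = u1 ∨ x = u2 := by
    intro p hp x hx
    obtain ⟨q, c, hq, hqd, hcd, hqc⟩ := cp_back hN (by omega) hp
    rcases star hp.1 hqd (by rw [hcd]; exact hp.2.1) hqc hx rfl with h | h
    · exact Or.inl h
    · exact Or.inr (hU q hq x h)
  have := rh_eq (f := f) (by omega) hne (by
    intro x hx
    rcases hx with hx | hx
    · exact key p1 h1 x (hx ▸ hu1)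
    · exact key p2 h2 x (hx ▸ hu2))
  rcases cheb_conj (by omega) hne this with h | h
  · exact hc1 h
  · exact hc2 h

theorem cv_form {p : K[X]} (hp : 0 < p.natDegree) {v : K} (hv : CVs p ⊆ {v}) :
    ∃ a t0 : K, a ≠ 0 ∧ p = C a * (X - C t0) ^ p.natDegree + C v := by
  classical
  have h0 : derivative p ≠ 0 := fun h0 => hp.ne' (derivative_eq_zero.1 h0)
  have hpv : p - C v ≠ 0 := by
    intro h0
    have := natDegree_sub_C (p := p) (a := v)
    rw [h0, natDegree_zero] at this; omega
  have hdvd : derivative p ∣ p - C v := by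
    rw [IsAlgClosed.dvd_iff_roots_le_roots h0 hpv, Multiset.le_iff_count]
    intro x
    rw [count_roots, count_roots]
    by_cases hr : (derivative p).IsRoot x
    · have h1 : p.eval x = v := hv ⟨x, hr, rfl⟩
      have h2 : (p - C v).IsRoot x := by simp [IsRoot, h1]
      have h3 := derivative_rootMultiplicity_of_root h2
      rw [derivative_sub, derivative_C, sub_zero] at h3
      omega
    · rw [rootMultiplicity_eq_zero hr]; omega
  obtain ⟨q, hq⟩ := hdvd
  have hq0 : q ≠ 0 := by rintro rfl; rw [mul_zero] at hq; exact hpv hq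
  have hqd : q.natDegree = 1 := by
    have := congrArg natDegree hq
    rw [natDegree_sub_C, natDegree_mul h0 hq0, natDegree_derivative] at this
    omega
  obtain ⟨s, b, hs, rfl⟩ := lin_form hqd
  set t0 := -(b / s) with ht0
  set R := (p - C v).comp (X + C t0) with hR
  have hRd : R.natDegree = p.natDegree := by
    rw [hR, natDegree_comp, natDegree_X_add_C, mul_one, natDegree_sub_C]
  have hRe : R = C s * (X * derivative R) := by
    have h1 : derivative R = (derivative p).comp (X + C t0) := by
      rw [hR, derivative_comp]; simp
    rw [h1]
    have h2 := congrArg (fun w => w.comp (X + C t0)) hq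
    simp only [mul_comp] at h2
    rw [hR, h2]
    simp only [add_comp, mul_comp, C_comp, X_comp]
    have : C s * (C t0) + C b = 0 := by
      rw [← C_mul, ← C_add, ht0, C_eq_zero]; field_simp; ring
    linear_combination (derivative p).comp (X + C t0) * this
  have hco : ∀ j, R.coeff j = s * (j * R.coeff j) := by
    intro j
    conv_lhs => rw [hRe, coeff_C_mul, coeff_X_mul_deriv]
  have hR0 : R ≠ 0 := by rintro h; rw [h] at hRd; simp at hRd; omega
  have hlc : R.coeff p.natDegree ≠ 0 := by
    rw [← hRd]; exact leadingCoeff_ne_zero.2 hR0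
  have hsm : s * p.natDegree = 1 := by
    apply mul_right_cancel₀ hlc
    rw [one_mul, mul_assoc, ← hco]
  have hRm : R = C (R.coeff p.natDegree) * X ^ p.natDegree := by
    ext j
    rw [coeff_C_mul_X_pow]
    split_ifs with hj
    · rw [hj]
    · by_contra h1
      have h2 : s * j = 1 := by
        apply mul_right_cancel₀ h1
        rw [one_mul, mul_assoc, ← hco]
      have h3 : (j : K) = p.natDegree := by
        apply mul_left_cancel₀ hs; rw [h2, hsm]
      exact hj (by exact_mod_cast h3)
  refine ⟨R.coeff p.natDegree, t0, hlc, ?_⟩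
  have h1 : R.comp (X - C t0) = p - C v := by
    rw [hR, comp_assoc]; simp
  rw [hRm] at h1
  simp only [mul_comp, C_comp, pow_comp, X_comp] at h1
  rw [h1]; ring

theorem cp_lin {f : K[X]} {N : ℕ} (hN : 1 ≤ N) (hf : Disintegrated f) {p p2 : K[X]}
    (h : CP f N p) (h2 : CP f N p2) (hd : p2.natDegree = p.natDegree) :
    ∃ l : K[X], l.natDegree = 1 ∧ p2 = p.comp l := by
  obtain ⟨v, hv⟩ := cp_single hN hf
  obtain ⟨a, t, ha, e1⟩ := cv_form h.1 (hv p h)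
  obtain ⟨b, t2, hb, e2⟩ := cv_form h2.1 (hv p2 h2)
  obtain ⟨s, hs⟩ := IsAlgClosed.exists_pow_nat_eq (b / a) h.1
  have hs0 : s ≠ 0 := by
    rintro rfl
    rw [zero_pow h.1.ne'] at hs
    exact div_ne_zero hb ha hs.symm
  refine ⟨C s * X + C (t - s * t2), natDegree_linear hs0, ?_⟩
  rw [e2, hd]
  conv_rhs => rw [e1]
  simp only [add_comp, mul_comp, C_comp, pow_comp, X_comp, sub_comp]
  have h3 : C s * X + C (t - s * t2) - C t = C s * (X - C t2) := by
    simp only [C_sub, C_mul]; ring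
  rw [h3, mul_pow, ← mul_assoc, ← C_pow, ← C_mul, hs, mul_div_cancel₀ _ ha]

theorem cp_semi {f : K[X]} {N : ℕ} (hN : 1 ≤ N) (hf : Disintegrated f) {p : K[X]}
    (h : CP f N p) : ∃ e, f.comp p = p.comp e := by
  obtain ⟨p2, c, h2, hd, -, e⟩ := cp_forward hN (by have := hf.1; omega) h
  obtain ⟨l, -, rfl⟩ := cp_lin hN hf h h2 hd
  exact ⟨l.comp c, by rw [e, comp_assoc]⟩

end USB

namespace USB
variable {K : Type*} [Field K] [CharZero K] [IsAlgClosed K]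

theorem coprime_div_gcd {m M d : ℕ} (hm : 0 < m) (hM : m ≤ M) :
    Nat.Coprime (m / Nat.gcd m (d ^ M)) d := by
  rw [Nat.coprime_iff_gcd_eq_one, ← Nat.coprime_iff_gcd_eq_one]
  apply Nat.Coprime.symm
  apply Nat.coprime_of_dvd
  intro q hq hqd hqm
  obtain ⟨k, n, hn, hmk⟩ := Nat.exists_eq_pow_mul_and_not_dvd hm.ne' q hq.ne_one
  have hkm : q ^ k ∣ m := ⟨n, hmk⟩
  have hk : k < m := lt_of_lt_of_le (Nat.lt_pow_self hq.one_lt) (Nat.le_of_dvd hm hkm)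
  have h1 : q ^ k ∣ Nat.gcd m (d ^ M) :=
    Nat.dvd_gcd hkm ((pow_dvd_pow q (by omega)).trans (pow_dvd_pow_of_dvd hqd M))
  have h2 : q * q ^ k ∣ m := by
    have := mul_dvd_mul hqm h1
    rwa [Nat.div_mul_cancel (Nat.gcd_dvd_left _ _)] at this
  rw [hmk, mul_comm] at h2
  exact hn (Nat.dvd_of_mul_dvd_mul_left (pow_pos hq.pos k) h2)

theorem lemmaD {f p η : K[X]} {N : ℕ} (hN : 1 ≤ N) (hf : Disintegrated f)
    (hp : 0 < p.natDegree) (h : (polyIter f N).comp p = p.comp η) :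
    ∃ e, f.comp p = p.comp e := by
  have hf2 : 2 ≤ f.natDegree := hf.1
  set m := p.natDegree with hm
  set M := N * m with hM
  have hMm : m ≤ M := Nat.le_mul_of_pos_left m hN
  have hM1 : 1 ≤ M := by omega
  obtain ⟨y, hy⟩ : ∃ y, (polyIter f M).comp p = p.comp y := by
    refine ⟨polyIter η m, ?_⟩
    rw [hM, it_mul]; exact it_semi h m
  have hyd := semi_natDegree (by omega) hy
  rw [it_natDegree] at hyd
  have hδ : 0 < f.natDegree ^ M := pow_pos (by omega) _
  obtain ⟨c, p1, h', h1, h2, h3⟩ := engstrom (A := polyIter f M) (B := p) (x := p) (y := y)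
    (by omega) (by omega) (by rw [it_natDegree]; exact hδ) hy
  rw [← hm, hyd] at h1
  have hcd : 0 < c.natDegree := by rw [h1]; exact Nat.gcd_pos_of_pos_left _ hp
  have hp1 : p1.natDegree = m / Nat.gcd m (f.natDegree ^ M) := by
    have := congrArg natDegree h2
    rw [natDegree_comp, ← hm] at this
    rw [← h1]; exact (Nat.div_eq_of_eq_mul_left hcd this).symm
  have hp1pos : 0 < p1.natDegree := by
    rcases Nat.eq_zero_or_pos p1.natDegree with h0 | h0
    · have := congrArg natDegree h2
      rw [natDegree_comp, ← hm, h0] at this; omega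
    · exact h0
  have hh' : 0 < h'.natDegree := by
    rcases Nat.eq_zero_or_pos h'.natDegree with h0 | h0
    · have := congrArg natDegree h3
      rw [natDegree_comp, hyd, h0] at this; omega
    · exact h0
  have e0 : (polyIter f M).comp p1 = p1.comp (c.comp h') := by
    apply comp_right_cancel hcd
    rw [comp_assoc, ← h2, hy, h3, comp_assoc, comp_assoc, ← comp_assoc p1, ← h2]
  have hcp : CP f M p1 := ⟨hp1pos, by rw [hp1]; exact coprime_div_gcd hp hMm, _, e0⟩
  obtain ⟨e1, he1⟩ := cp_semi hM1 hf hcp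
  have he1M := it_semi he1 M
  have e1d := semi_natDegree hp1pos he1
  obtain ⟨l, hl, hl1, hl2⟩ := left_cancel (p := p1) (a := polyIter e1 M) (b := c.comp h') hp1pos
    (by rw [natDegree_comp]; positivity)
    (by rw [it_natDegree, e1d, natDegree_comp, mul_comm, ← natDegree_comp, ← h3, hyd])
    (by rw [← he1M, e0])
  rw [← comp_assoc] at hl1
  set ct := l.comp c with hct
  have hpct : p = p1.comp ct := by rw [hct, ← comp_assoc, hl2, ← h2]
  have hctd : 0 < ct.natDegree := by rw [hct, natDegree_comp, hl]; omega
  have he : (e1.comp ct).comp h' = ct.comp (h'.comp e1) := by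
    rw [comp_assoc, ← hl1, ← comp_assoc, ← hl1, ← it_succ, ← it_succ']
  obtain ⟨b, hb⟩ := right_factor (A := e1.comp ct) (B := ct) (x := h') (y := h'.comp e1) hh'
    (by rw [natDegree_comp, e1d]; positivity)
    (by rw [natDegree_comp, e1d]; positivity) he (by rw [natDegree_comp]; exact dvd_mul_right _ _)
  have hfin : e1.comp ct = ct.comp b := by
    apply comp_right_cancel hh'
    rw [he, hb]; exact (comp_assoc _ _ _).symm
  refine ⟨b, ?_⟩
  rw [hpct, ← comp_assoc, he1, comp_assoc, hfin]; exact (comp_assoc _ _ _).symm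

theorem it_X_pow (d n : ℕ) : polyIter (X ^ d : K[X]) n = X ^ (d ^ n) := by
  induction n with
  | zero => simp [it_zero]
  | succ n ih => rw [it_succ, ih, pow_comp, X_comp, ← pow_mul, pow_succ]

theorem lemmaP0 {g q : K[X]} (hg : Disintegrated g) (hq : 0 < q.natDegree)
    (h : g.comp q = q.comp (X ^ g.natDegree)) : False := by
  obtain ⟨hg2, hgX, -, -⟩ := id hg
  set d := g.natDegree with hd
  set m := q.natDegree with hm
  have hM := it_semi h m
  rw [it_X_pow] at hM
  have hδ : 0 < d ^ m := pow_pos (by omega) _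
  obtain ⟨c, q1, y', h1, h2, h3⟩ := engstrom (A := polyIter g m) (B := q) (x := q)
    (y := X ^ (d ^ m)) (by omega) (by rw [natDegree_X_pow]; exact hδ)
    (by rw [it_natDegree]; exact hδ) hM
  rw [natDegree_X_pow, ← hm] at h1
  set G := Nat.gcd m (d ^ m) with hG
  have hGpos : 0 < G := Nat.gcd_pos_of_pos_left _ hq
  obtain ⟨k, hk⟩ : G ∣ d ^ m := Nat.gcd_dvd_right _ _
  have hk0 : 0 < k := by
    rcases Nat.eq_zero_or_pos k with h0 | h0
    · rw [h0] at hk; omega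
    · exact h0
  obtain ⟨l, hl⟩ := right_factor (A := X ^ k) (B := y') (x := X ^ G) (y := c)
    (by rw [natDegree_X_pow]; exact hGpos) (by omega) (by rw [natDegree_X_pow]; exact hk0)
    (by rw [← h3, pow_comp, X_comp, ← pow_mul, hk]) (by rw [natDegree_X_pow, h1])
  set q2 := q1.comp l with hq2
  have hqq : q = q2.comp (X ^ G) := by rw [h2, hl, ← comp_assoc]
  have hq2m : m = q2.natDegree * G := by
    have := congrArg natDegree hqq
    rwa [natDegree_comp, natDegree_X_pow] at this
  have hq2d : q2.natDegree = m / G := by rw [hq2m, Nat.mul_div_cancel _ hGpos]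
  have hq2pos : 0 < q2.natDegree := by
    rcases Nat.eq_zero_or_pos q2.natDegree with h0 | h0
    · rw [h0] at hq2m; omega
    · exact h0
  have hcomm : ∀ a b : ℕ, (X ^ a : K[X]).comp (X ^ b) = (X ^ b : K[X]).comp (X ^ a) := by
    intro a b; simp only [pow_comp, X_comp, ← pow_mul, mul_comm]
  have hsem : g.comp q2 = q2.comp (X ^ d) := by
    apply comp_right_cancel (h := X ^ G) (by rw [natDegree_X_pow]; exact hGpos)
    have hx := hcomm G d
    calc (g.comp q2).comp (X ^ G) = g.comp q := by rw [comp_assoc, ← hqq]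
      _ = (q2.comp (X ^ G)).comp (X ^ d) := by rw [h, hqq]
      _ = q2.comp ((X ^ G : K[X]).comp (X ^ d)) := comp_assoc _ _ _
      _ = _ := by rw [hx]; exact (comp_assoc _ _ _).symm
  have hcp : CP g 1 q2 := ⟨hq2pos, by rw [hq2d]; exact coprime_div_gcd hq le_rfl, X ^ d, by
    rw [it_one]; exact hsem⟩
  obtain ⟨v, hv⟩ := cp_single le_rfl hg
  obtain ⟨a, t0, ha, hform⟩ := cv_form hq2pos (hv q2 hcp)
  set n := q2.natDegree with hn
  rcases Nat.lt_or_ge n 2 with hn2 | hn2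
  · exact hgX (linConj_of' (l := q2) (by omega) hsem)
  · have : NeZero (n : K) := ⟨by exact_mod_cast (by omega : n ≠ 0)⟩
    obtain ⟨w, hw⟩ := HasEnoughRootsOfUnity.exists_primitiveRoot K n
    have hw1 : w ≠ 1 := hw.ne_one (by omega)
    have hw0 : w ≠ 0 := hw.ne_zero (by omega)
    set rot : K[X] := C w * X + C (t0 * (1 - w)) with hrot
    have hrotd : rot.natDegree = 1 := natDegree_linear hw0
    have hinv : q2.comp rot = q2 := by
      rw [hform]
      simp only [add_comp, mul_comp, C_comp, pow_comp, X_comp, sub_comp]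
      have h3 : rot - C t0 = C w * (X - C t0) := by
        simp only [hrot, C_sub, C_mul, C_1]; ring
      rw [h3, mul_pow, ← C_pow, hw.pow_eq_one, C_1, one_mul]
    obtain ⟨L, hL, hL1, -⟩ := left_cancel (p := q2) (a := (X ^ d : K[X]).comp rot) (b := X ^ d)
      (by omega) (by rw [natDegree_X_pow]; omega) (by rw [natDegree_comp, hrotd, mul_one])
      (by rw [← comp_assoc, ← hsem, comp_assoc, hinv])
    obtain ⟨al, be, -, rfl⟩ := lin_form hL
    have hder := congrArg (fun r => eval 0 (derivative r)) hL1
    have hd0 : (d : K) ≠ 0 := by exact_mod_cast (by omega : d ≠ 0)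
    simp only [pow_comp, X_comp, hrot, add_comp, mul_comp, C_comp, derivative_pow, derivative_add,
      derivative_mul, derivative_C, derivative_X, eval_add, eval_mul, eval_C, eval_X, eval_pow] at hder
    simp [hd0, hw0, zero_pow (show d - 1 ≠ 0 by omega)] at hder
    have ht0 : t0 = 0 := by
      rcases hder.1 with h | h
      · exact h
      · exact absurd (sub_eq_zero.1 h).symm hw1
    rw [ht0, C_0, sub_zero] at hform
    apply hgX
    apply linConj_of' (l := C a * X + C v) (natDegree_linear ha)
    apply comp_right_cancel (h := X ^ n) (by rw [natDegree_X_pow]; omega)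
    have hq3 : (C a * X + C v).comp (X ^ n) = q2 := by
      rw [hform]; simp
    have hx := hcomm n d
    calc (g.comp (C a * X + C v)).comp (X ^ n) = g.comp q2 := by rw [comp_assoc, hq3]
      _ = q2.comp (X ^ d) := hsem
      _ = ((C a * X + C v).comp (X ^ n)).comp (X ^ d) := by rw [hq3]
      _ = (C a * X + C v).comp ((X ^ n : K[X]).comp (X ^ d)) := comp_assoc _ _ _
      _ = _ := by rw [hx]; exact (comp_assoc _ _ _).symm

theorem lemmaP {g q : K[X]} (hg : Disintegrated g) (hq : 0 < q.natDegree) {ε : K} (hε : ε ≠ 0)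
    (h : g.comp q = q.comp (C ε * X ^ g.natDegree)) : False := by
  have hg2 : 2 ≤ g.natDegree := hg.1
  obtain ⟨s, hs⟩ := IsAlgClosed.exists_pow_nat_eq ε⁻¹ (show 0 < g.natDegree - 1 by omega)
  have hs0 : s ≠ 0 := by
    rintro rfl
    rw [zero_pow (by omega)] at hs
    exact inv_ne_zero hε hs.symm
  apply lemmaP0 (q := q.comp (C s * X)) hg
  · rw [natDegree_comp, natDegree_C_mul_X _ hs0]; omega
  · rw [← comp_assoc, h, comp_assoc, comp_assoc]
    congr 1
    simp only [mul_comp, C_comp, pow_comp, X_comp, mul_pow, ← C_pow, ← mul_assoc, ← C_mul]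
    congr 2
    have : s ^ g.natDegree = s ^ (g.natDegree - 1) * s := by
      rw [← pow_succ, Nat.sub_add_cancel (by omega)]
    rw [this, hs, ← mul_assoc, mul_inv_cancel₀ hε, one_mul]

end USB

namespace USB
variable {K : Type*} [Field K] [CharZero K] [IsAlgClosed K]

theorem coeff_shift {e : K[X]} (a b : K) (he : 1 ≤ e.natDegree) :
    (e.comp (C a * X + C b)).coeff (e.natDegree - 1) =
      (e.coeff (e.natDegree - 1) + e.natDegree * e.leadingCoeff * b) * a ^ (e.natDegree - 1) := by
  have h1 : e.comp (C a * X + C b) = (taylor b e).comp (C a * X) := by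
    rw [taylor_apply, comp_assoc]; simp
  rw [h1, comp_C_mul_X_coeff, taylor_coeff]
  congr 1
  have hd : (hasseDeriv (e.natDegree - 1) e).natDegree < 2 := by
    have := natDegree_hasseDeriv_le e (e.natDegree - 1)
    omega
  rw [eval_eq_sum_range' hd, Finset.sum_range_succ, Finset.sum_range_one, hasseDeriv_coeff,
    hasseDeriv_coeff]
  have h2 : 1 + (e.natDegree - 1) = e.natDegree := by omega
  rw [h2, zero_add, Nat.choose_self, leadingCoeff, Nat.choose_symm (by omega : 1 ≤ e.natDegree)]
  simp

theorem cent {e l m : K[X]} (he : 2 ≤ e.natDegree) (h0 : e.coeff (e.natDegree - 1) = 0)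
    (hl : l.natDegree = 1) (hm : m.natDegree = 1) (h : e.comp l = m.comp e) :
    ∃ a : K, a ≠ 0 ∧ l = C a * X := by
  obtain ⟨a, b, ha, rfl⟩ := lin_form hl
  obtain ⟨a', b', ha', rfl⟩ := lin_form hm
  refine ⟨a, ha, ?_⟩
  have h1 := congrArg (fun r => r.coeff (e.natDegree - 1)) h
  simp only [coeff_shift a b (by omega : 1 ≤ e.natDegree)] at h1
  have h2 : ((C a' * X + C b').comp e).coeff (e.natDegree - 1) = 0 := by
    simp only [add_comp, mul_comp, C_comp, X_comp, coeff_add, coeff_C_mul, h0]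
    rw [coeff_C_ne_zero (by omega)]; simp
  rw [h2, h0, zero_add] at h1
  have h3 : (e.natDegree : K) ≠ 0 := by exact_mod_cast (by omega : e.natDegree ≠ 0)
  have h4 : e.leadingCoeff ≠ 0 := by
    rw [Ne, leadingCoeff_eq_zero]; rintro rfl; simp at he
  have hb : b = 0 := by
    simpa [h3, h4, ha, pow_ne_zero] using h1
  rw [hb]; simp

/-- existence of a centring translation -/
theorem centring {e : K[X]} (he : 2 ≤ e.natDegree) :
    ∃ b : K, ((X - C b).comp (e.comp (X + C b))).coeff (e.natDegree - 1) = 0 := by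
  have h3 : (e.natDegree : K) ≠ 0 := by exact_mod_cast (by omega : e.natDegree ≠ 0)
  have h4 : e.leadingCoeff ≠ 0 := by
    rw [Ne, leadingCoeff_eq_zero]; rintro rfl; simp at he
  refine ⟨-(e.coeff (e.natDegree - 1)) / (e.natDegree * e.leadingCoeff), ?_⟩
  set b := -(e.coeff (e.natDegree - 1)) / (e.natDegree * e.leadingCoeff) with hb
  have h5 := coeff_shift (e := e) 1 b (by omega)
  rw [C_1, one_mul] at h5
  rw [sub_comp, X_comp, C_comp, coeff_sub, h5, coeff_C_ne_zero (by omega), hb]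
  field_simp
  simp

/-- all iterates up to `N` are linearly related -/
theorem lin_rel {e1 e L : K[X]} {N j : ℕ} (he : 2 ≤ e.natDegree) (hd : e1.natDegree = e.natDegree)
    (hL : L.natDegree = 1) (h : polyIter e1 N = L.comp (polyIter e N)) (hj : j ≤ N) :
    ∃ l : K[X], l.natDegree = 1 ∧ polyIter e1 j = l.comp (polyIter e j) := by
  have hpos : ∀ k, 0 < e.natDegree ^ k := fun k => pow_pos (by omega) k
  obtain ⟨i, rfl⟩ := Nat.exists_eq_add_of_le' hj
  rw [it_add, it_add, ← comp_assoc] at h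
  obtain ⟨l, hl⟩ := right_factor (x := polyIter e j) (y := polyIter e1 j)
    (by rw [it_natDegree]; exact hpos _) (by rw [it_natDegree, hd]; exact hpos _)
    (by rw [natDegree_comp, hL, one_mul, it_natDegree]; exact hpos _) h.symm
    (by rw [it_natDegree, it_natDegree, hd])
  refine ⟨l, ?_, hl⟩
  have h2 := congrArg natDegree hl
  rw [natDegree_comp, it_natDegree, it_natDegree, hd] at h2
  have := hpos j
  nlinarith

theorem core {e1 e L : K[X]} {N : ℕ} (he : 2 ≤ e.natDegree) (hd : e1.natDegree = e.natDegree)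
    (h0 : e.coeff (e.natDegree - 1) = 0) (hmon : ∃ i, i < e.natDegree ∧ e.coeff i ≠ 0)
    (hN : 3 ≤ N) (hL : L.natDegree = 1) (h : polyIter e1 N = L.comp (polyIter e N)) :
    ∃ M, 1 ≤ M ∧ M ≤ e.natDegree ∧ polyIter e1 M = L.comp (polyIter e M) := by
  have hpos : ∀ k, 0 < (polyIter e k).natDegree := fun k => by
    rw [it_natDegree]; exact pow_pos (by omega) k
  obtain ⟨l1, d1, r1⟩ := lin_rel (j := 1) he hd hL h (by omega)
  obtain ⟨l2, d2, r2⟩ := lin_rel (j := 2) he hd hL h (by omega)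
  obtain ⟨l3, d3, r3⟩ := lin_rel (j := 3) he hd hL h (by omega)
  obtain ⟨li, di, i1, i2⟩ := lin_inv d1
  rw [it_one, it_one] at r1
  have s2 : e.comp l1 = (li.comp l2).comp e := by
    apply comp_right_cancel (h := e) (by omega)
    calc (e.comp l1).comp e = (li.comp l1).comp (e.comp (l1.comp e)) := by
          rw [i2, X_comp, comp_assoc]
      _ = li.comp ((l1.comp e).comp (l1.comp e)) := by rw [comp_assoc, comp_assoc]
      _ = li.comp (polyIter e1 2) := by rw [it_succ, it_one, r1]
      _ = _ := by rw [r2, it_succ, it_one, comp_assoc, comp_assoc]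
  have s3 : e.comp l2 = (li.comp l3).comp e := by
    apply comp_right_cancel (h := polyIter e 2) (hpos 2)
    calc (e.comp l2).comp (polyIter e 2) = (li.comp l1).comp (e.comp (l2.comp (polyIter e 2))) := by
          rw [i2, X_comp, comp_assoc]
      _ = li.comp ((l1.comp e).comp (l2.comp (polyIter e 2))) := by rw [comp_assoc, comp_assoc]
      _ = li.comp (polyIter e1 3) := by rw [it_succ e1 2, r2, r1]
      _ = _ := by rw [r3, it_succ e 2, comp_assoc, comp_assoc]
  obtain ⟨lam, hlam, rfl⟩ := cent he h0 d1 (by rw [natDegree_comp, di, d2]) s2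
  obtain ⟨mu, hmu, rfl⟩ := cent he h0 d2 (by rw [natDegree_comp, di, d3]) s3
  obtain ⟨i, hi, hci⟩ := hmon
  have hc := congrArg (fun p => (C lam * X : K[X]).comp p) s2
  rw [← comp_assoc, ← comp_assoc, ← comp_assoc, i1, X_comp] at hc
  have hlc : e.coeff e.natDegree ≠ 0 := by
    rw [coeff_natDegree, Ne, leadingCoeff_eq_zero]; rintro rfl; simp at he
  have hcoef : ∀ k, e.coeff k ≠ 0 → lam * lam ^ k = mu := by
    intro k hk
    have h1 := congrArg (fun r => r.coeff k) hc
    simp only [mul_comp, C_comp, X_comp, coeff_C_mul, comp_C_mul_X_coeff] at h1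
    apply mul_left_cancel₀ hk
    linear_combination h1
  set w := e.natDegree - i with hw
  have hpow : ∀ k, e.coeff k ≠ 0 → lam ^ k = lam ^ e.natDegree := fun k hk =>
    mul_left_cancel₀ hlam ((hcoef k hk).trans (hcoef _ hlc).symm)
  have hlw : lam ^ w = 1 := by
    have h1 := hpow i hci
    have h2 : lam ^ e.natDegree = lam ^ w * lam ^ i := by rw [← pow_add]; congr 1; omega
    rw [h2] at h1
    exact (mul_right_cancel₀ (pow_ne_zero i hlam) ((one_mul _).trans h1)).symm
  -- the sequence of multipliers, in terms of powers of `lam`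
  have hsub : ∀ n : ℕ, e.comp (C (lam ^ n) * X) = C ((lam ^ n) ^ e.natDegree) * e := by
    intro n
    ext k
    rw [comp_C_mul_X_coeff, coeff_C_mul, mul_comm]
    by_cases hk : e.coeff k = 0
    · simp [hk]
    · rw [← pow_mul, mul_comm n, pow_mul, hpow k hk, ← pow_mul, ← pow_mul, mul_comm n]
  let s : K → K := fun a => lam * a ^ e.natDegree
  let a : ℕ → K := fun k => s^[k] lam
  have ha : ∀ k, ∃ n : ℕ, a k = lam ^ n := by
    intro k
    induction k with
    | zero => exact ⟨1, by simp [a]⟩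
    | succ k ih =>
      obtain ⟨n, hn⟩ := ih
      refine ⟨n * e.natDegree + 1, ?_⟩
      simp only [a, Function.iterate_succ_apply'] at hn ⊢
      rw [hn]; simp only [s]; ring
  have hit : ∀ k, polyIter e1 (k+1) = (C (a k) * X).comp (polyIter e (k+1)) := by
    intro k
    induction k with
    | zero => rw [zero_add, it_one, it_one, r1]; rfl
    | succ k ih =>
      obtain ⟨n, hn⟩ := ha k
      have h1 : a (k+1) = lam * (lam ^ n) ^ e.natDegree := by
        rw [← hn]; simp only [a, Function.iterate_succ_apply']; rfl
      rw [it_succ, ih, h1, hn, r1, comp_assoc, ← comp_assoc e, hsub, it_succ e (k+1)]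
      simp only [mul_comp, C_comp, X_comp, C_mul, mul_assoc]
  obtain ⟨N', rfl⟩ : ∃ N', N = N' + 1 := ⟨N - 1, by omega⟩
  have hLN : L = C (a N') * X := by
    apply comp_right_cancel (hpos (N'+1))
    rw [← h, hit]
  -- pigeonhole
  have hex : ∃ k, a k = a N' := ⟨N', rfl⟩
  classical
  have hk := Nat.find_spec hex
  have hmin : ∀ j, j < Nat.find hex → a j ≠ a N' := fun j hj => Nat.find_min hex hj
  set k0 := Nat.find hex with hk0
  refine ⟨k0 + 1, by omega, ?_, by rw [hit, hk, hLN]⟩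
  have hinj : Set.InjOn a (Finset.range (k0+1)) := by
    have key : ∀ x y, x < y → y ≤ k0 → a x ≠ a y := by
      intro x y hxy hy hxy'
      apply hmin (x + (k0 - y)) (by omega)
      rw [← hk]
      have : ∀ t, a (x + t) = a (y + t) := by
        intro t
        simp only [a] at hxy' ⊢
        rw [add_comm x, add_comm y, Function.iterate_add_apply, hxy', ← Function.iterate_add_apply]
      rw [this, Nat.add_sub_cancel' hy]
    intro x hx y hy hxy
    simp only [Finset.coe_range, Set.mem_Iio] at hx hy
    rcases lt_trichotomy x y with h1 | h1 | h1
    · exact absurd hxy (key x y h1 (by omega))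
    · exact h1
    · exact absurd hxy.symm (key y x h1 (by omega))
  have hwpos : 0 < w := by omega
  have hcard : (Finset.range (k0+1)).card ≤ (nthRoots w (1:K)).toFinset.card := by
    apply Finset.card_le_card_of_injOn a _ hinj
    intro x _
    obtain ⟨n, hn⟩ := ha x
    simp only [Finset.mem_coe, Multiset.mem_toFinset, mem_nthRoots hwpos]
    rw [hn, ← pow_mul, mul_comm, pow_mul, hlw, one_pow]
  rw [Finset.card_range] at hcard
  have h1 := (hcard.trans (Multiset.toFinset_card_le _)).trans (card_nthRoots w 1)
  omega

theorem final {f g : K[X]} (hf : Disintegrated f) (hg : Disintegrated g) (hfg : PolyApprox f g) :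
    ∃ N : ℕ, 1 ≤ N ∧ N ≤ g.natDegree ∧ ∃ η : K[X], 2 ≤ η.natDegree ∧
      SemiconjTo η (polyIter f N) ∧ SemiconjTo η (polyIter g N) := by
  obtain ⟨N0, hN0, η0, hη0, ⟨p0, hp0, hfp0⟩, ⟨q0, hq0, hgq0⟩⟩ := hfg
  have hg2 : 2 ≤ g.natDegree := hg.1
  obtain ⟨e0, he0⟩ := lemmaD hN0 hg hq0 hgq0
  have e0d := semi_natDegree hq0 he0
  obtain ⟨b, hb⟩ := centring (e := e0) (by omega)
  -- conjugate by the translation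
  have hid : (X + C b : K[X]).comp (X - C b) = X := by simp
  have hXd : (X + C b : K[X]).natDegree = 1 := natDegree_X_add_C b
  have htr : ∀ F P E : K[X], F.comp P = P.comp E →
      F.comp (P.comp (X + C b)) = (P.comp (X + C b)).comp ((X - C b).comp (E.comp (X + C b))) := by
    intro F P E hE
    calc F.comp (P.comp (X + C b)) = P.comp (E.comp (X + C b)) := by
          rw [← comp_assoc, hE, comp_assoc]
      _ = P.comp (((X + C b : K[X]).comp (X - C b)).comp (E.comp (X + C b))) := by
          rw [hid, X_comp]
      _ = _ := by simp only [comp_assoc]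
  have hfp1 := htr _ _ _ hfp0
  have hgq1 := htr _ _ _ hgq0
  have he2 := htr _ _ _ he0
  have hp : 0 < (p0.comp (X + C b)).natDegree := by rw [natDegree_comp, hXd, mul_one]; exact hp0
  have hq : 0 < (q0.comp (X + C b)).natDegree := by rw [natDegree_comp, hXd, mul_one]; exact hq0
  rw [e0d] at hb
  generalize p0.comp (X + C b) = p at *
  generalize q0.comp (X + C b) = q at *
  generalize (X - C b : K[X]).comp (e0.comp (X + C b)) = e at *
  generalize (X - C b : K[X]).comp (η0.comp (X + C b)) = η1 at *
  -- pass to the third iterate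
  have hfp := it_semi hfp1 3
  have hgq := it_semi hgq1 3
  rw [← it_mul] at hfp hgq
  generalize polyIter η1 3 = η at *
  have hN : 3 ≤ N0 * 3 := by omega
  generalize N0 * 3 = N at *
  have hηf := semi_natDegree hp hfp
  have hηg := semi_natDegree hq hgq
  rw [it_natDegree] at hηf hηg
  have hfgd : f.natDegree = g.natDegree :=
    Nat.pow_left_injective (n := N) (by omega) (hηf.symm.trans hηg)
  obtain ⟨e1, he1⟩ := lemmaD (by omega) hf hp hfp
  have e1d := semi_natDegree hp he1
  have ed := semi_natDegree hq he2
  have hηpos : 0 < η.natDegree := by rw [hηg]; exact pow_pos (by omega) _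
  obtain ⟨L1, dL1, hL1, pL1⟩ := left_cancel (p := p) (a := polyIter e1 N) (b := η) hp hηpos
    (by rw [it_natDegree, e1d, hηf]) (by rw [← it_semi he1, hfp])
  obtain ⟨L2, dL2, hL2, qL2⟩ := left_cancel (p := q) (a := polyIter e N) (b := η) hq hηpos
    (by rw [it_natDegree, ed, hηg]) (by rw [← it_semi he2, hgq])
  obtain ⟨Li, dLi, i1, i2⟩ := lin_inv dL2
  have hL : polyIter e1 N = (L1.comp Li).comp (polyIter e N) := by
    rw [hL1, hL2, comp_assoc, ← comp_assoc Li, i2, X_comp]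
  have hmon : ∃ i, i < e.natDegree ∧ e.coeff i ≠ 0 := by
    by_contra hcon
    push Not at hcon
    have hform : e = C e.leadingCoeff * X ^ g.natDegree := by
      ext k
      rw [coeff_C_mul, coeff_X_pow]
      rcases lt_trichotomy k e.natDegree with h1 | h1 | h1
      · rw [hcon k h1, if_neg (by omega)]; simp
      · rw [if_pos (by omega), h1]; simp
      · rw [coeff_eq_zero_of_natDegree_lt h1, if_neg (by omega)]; simp
    refine lemmaP hg hq (ε := e.leadingCoeff) ?_ (by rw [← hform]; exact he2)
    rw [Ne, leadingCoeff_eq_zero]; intro h0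
    rw [h0, natDegree_zero] at ed; omega
  obtain ⟨M, hM1, hM2, hM⟩ := core (by omega) (by omega) (by rw [ed]; exact hb) hmon hN
    (by rw [natDegree_comp, dL1, dLi]) hL
  refine ⟨M, hM1, by omega, Li.comp (polyIter e M), ?_, ⟨p, hp, ?_⟩, ⟨q, hq, ?_⟩⟩
  · rw [natDegree_comp, dLi, one_mul, it_natDegree, ed]
    exact hg2.trans (Nat.le_self_pow (by omega) _)
  · rw [it_semi he1, hM, comp_assoc, ← comp_assoc p, pL1]
  · rw [it_semi he2, ← comp_assoc]
    congr 1
    calc q = q.comp (L2.comp Li) := by rw [i1, comp_X]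
      _ = _ := by rw [← comp_assoc, qL2]

end USB

/-- **Uniform bound for semiconjugacy.** If `f ≈ g` are disintegrated polynomials of degree
at most `d`, then there exist `N ≤ 2d⁴` and a common polynomial `η` of degree at least 2
semiconjugate to both `f^{∘N}` and `g^{∘N}`. -/
theorem uniform_semiconjugacy_bound {K : Type*} [Field K] [IsAlgClosed K] [CharZero K]
    (d : ℕ) (hd : 2 ≤ d) (f g : K[X])
    (hf : Disintegrated f) (hg : Disintegrated g)
    (hfd : f.natDegree ≤ d) (hgd : g.natDegree ≤ d)
    (hfg : PolyApprox f g) :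
    ∃ N : ℕ, 1 ≤ N ∧ N ≤ 2 * d ^ 4 ∧ ∃ η : K[X], 2 ≤ η.natDegree ∧
      SemiconjTo η (polyIter f N) ∧ SemiconjTo η (polyIter g N) := by
  obtain ⟨N, h1, h2, h3⟩ := USB.final hf hg hfg
  refine ⟨N, h1, ?_, h3⟩
  have h4 : d ≤ d ^ 4 := Nat.le_self_pow (by omega) d
  omega
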